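/- arXiv:2206.10522 — 2 statements merged into one kernel-verified Lean document; each statement's English description precedes it below -/
import Mathlib

section
/- Let n ≥ 2, N = n(n−1)/2, and let (i_1,…,i_N) be a reduced expression for the longest element w₀ of S_n, with associated sequence of positive roots β_1,…,β_N. Let m_1,…,m_N ∈ 𝐊 be positive generalized Puiseux series with Val(m_j) ≥ 0 for all j. If the n×n matrix Y := y_{i_1}(m_1⁻¹)·y_{i_2}(m_2⁻¹)⋯y_{i_N}(m_N⁻¹) over 𝐊 is a Toeplitz matrix (i.e. Y_{a,b} = Y_{a+1,b+1} for all 1 ≤ a, b ≤ n−1), then the family {μ_{ab}}_{1≤a<b≤n} defined by μ_{β_j} := Val(m_j) is an ideal filling: μ_{ab} ≥ 0 for all a < b and μ_{ab} = max(μ_{a+1,b}, μ_{a,b−1}) whenever b − a ≥ 2. -/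
open Matrix

/-- `yMat n 𝕂 i z` is the n×n identity matrix except entry (i+1, i) (1-based) equals `z`. -/
def yMat (n : ℕ) (𝕂 : Type*) [Field 𝕂] (i : ℕ) (z : 𝕂) :
    Matrix (Fin n) (Fin n) 𝕂 :=
  fun a b => if a = b then 1 else if (a : ℕ) = i ∧ (b : ℕ) + 1 = i then z else 0

/-- `xMat n 𝕂 i z` is the n×n identity matrix except entry (i, i+1) (1-based) equals `z`. -/
def xMat (n : ℕ) (𝕂 : Type*) [Field 𝕂] (i : ℕ) (z : 𝕂) :
    Matrix (Fin n) (Fin n) 𝕂 :=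
  fun a b => if a = b then 1 else if (a : ℕ) + 1 = i ∧ (b : ℕ) = i then z else 0

/-- `xNegMat n 𝕂 i z` is the identity except the 2×2 block in rows/cols i, i+1 (1-based)
equals [[z⁻¹, 0], [1, z]]. -/
noncomputable def xNegMat (n : ℕ) (𝕂 : Type*) [Field 𝕂] (i : ℕ) (z : 𝕂) :
    Matrix (Fin n) (Fin n) 𝕂 :=
  fun a b =>
    if (a : ℕ) + 1 = i ∧ (b : ℕ) + 1 = i then z⁻¹
    else if (a : ℕ) = i ∧ (b : ℕ) = i then z
    else if (a : ℕ) = i ∧ (b : ℕ) + 1 = i then 1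
    else if a = b then 1 else 0

/-- The matrix w̄₀ with (i, n+1−i) entry (−1)^(n−i) (1-based) and other entries 0. -/
def w0bar (n : ℕ) (𝕂 : Type*) [Field 𝕂] : Matrix (Fin n) (Fin n) 𝕂 :=
  fun a b => if (a : ℕ) + (b : ℕ) = n - 1 then (-1 : 𝕂) ^ (n - 1 - (a : ℕ)) else 0

/-- s_k = Σ_{j=1}^{k−1} (n−j). -/
def sIdx (n k : ℕ) : ℕ := ∑ j ∈ Finset.Icc 1 (k - 1), (n - j)

/-- The word 𝐢₀ = (1,2,…,n−1, 1,2,…,n−2, …, 1,2, 1). -/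
def wordI0 (n : ℕ) : List ℕ :=
  (List.range (n - 1)).flatMap (fun k => (List.range (n - 1 - k)).map (· + 1))

/-- The word 𝐢′₀ = (n−1,…,1, n−1,…,2, …, n−1,n−2, n−1). -/
def wordI0' (n : ℕ) : List ℕ :=
  (List.range (n - 1)).flatMap (fun k => (List.range (n - 1 - k)).map (fun a => n - 1 - a))

/-- The simple reflection s_i = (i, i+1) (1-based) as a permutation of `Fin n`. -/
def sPerm (n i : ℕ) : Equiv.Perm (Fin n) :=
  if h : 1 ≤ i ∧ i < n then Equiv.swap ⟨i - 1, by omega⟩ ⟨i, h.2⟩ else 1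

/-- The longest element of S_n, k ↦ n+1−k (1-based). -/
def w0Perm (n : ℕ) : Equiv.Perm (Fin n) where
  toFun a := ⟨n - 1 - (a : ℕ), by have := a.isLt; omega⟩
  invFun a := ⟨n - 1 - (a : ℕ), by have := a.isLt; omega⟩
  left_inv a := by
    have := a.isLt
    apply Fin.ext
    show n - 1 - (n - 1 - (a : ℕ)) = (a : ℕ)
    omega
  right_inv a := by
    have := a.isLt
    apply Fin.ext
    show n - 1 - (n - 1 - (a : ℕ)) = (a : ℕ)
    omega

/-- Apply a permutation of `Fin n` to a 1-based label in {1, …, n}. -/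
def permApp {n : ℕ} (σ : Equiv.Perm (Fin n)) (x : ℕ) : ℕ :=
  if h : 1 ≤ x ∧ x ≤ n then ((σ ⟨x - 1, by omega⟩ : Fin n) : ℕ) + 1 else x

/-- The field of generalized Puiseux series. -/
abbrev GPS := HahnSeries ℝ ℝ

/-- The determinant of the `k × k` block of `F` whose top left entry is at `(r, c)`. -/
def contiguousMinor {K : Type*} [Field K] (F : ℕ → ℕ → K) (r c k : ℕ) : K :=
  (Matrix.of fun a b : Fin k => F (r + a) (c + b)).det

/-- Place one index before `Fin m`. -/
noncomputable def equivFirst (m : ℕ) : Fin 1 ⊕ Fin m ≃ Fin (m + 1) :=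
  Equiv.ofBijective (Sum.elim (fun _ => 0) Fin.succ) <| by
    rw [Fintype.bijective_iff_injective_and_card]
    refine ⟨?_, by simp [add_comm]⟩
    rintro (x | x) (y | y) h <;> simp_all [Fin.ext_iff]

/-- Place one index after `Fin m`. -/
noncomputable def equivLast (m : ℕ) : Fin 1 ⊕ Fin m ≃ Fin (m + 1) :=
  Equiv.ofBijective (Sum.elim (fun _ => Fin.last m) Fin.castSucc) <| by
    rw [Fintype.bijective_iff_injective_and_card]
    refine ⟨?_, by simp [add_comm]⟩
    rintro (x | x) (y | y) h <;> simp_all [Fin.ext_iff] <;> omega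

/-- Place one index before and one after `Fin m`. -/
noncomputable def equivBoth (m : ℕ) : Fin 2 ⊕ Fin m ≃ Fin (m + 2) :=
  Equiv.ofBijective (Sum.elim ![0, Fin.last (m + 1)] fun x => x.succ.castSucc) <| by
    rw [Fintype.bijective_iff_injective_and_card]
    refine ⟨?_, by simp [add_comm]⟩
    rintro (x | x) (y | y) h
    · fin_cases x <;> fin_cases y <;> simp_all [Fin.ext_iff]
    · fin_cases x <;> simp_all [Fin.ext_iff]; omega
    · fin_cases y <;> simp_all [Fin.ext_iff]; omega
    · simp_all [Fin.ext_iff]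

/-- The Desnanot–Jacobi identity for contiguous minors with nonvanishing interior minor. -/
theorem contiguousMinor_desnanot_jacobi {K : Type*} [Field K] (F : ℕ → ℕ → K) (r c m : ℕ)
    (h : contiguousMinor F (r + 1) (c + 1) m ≠ 0) :
    contiguousMinor F r c (m + 2) * contiguousMinor F (r + 1) (c + 1) m =
      contiguousMinor F r c (m + 1) * contiguousMinor F (r + 1) (c + 1) (m + 1) -
        contiguousMinor F (r + 1) c (m + 1) * contiguousMinor F r (c + 1) (m + 1) := by
  set D : Matrix (Fin m) (Fin m) K := Matrix.of fun a b => F (r + 1 + a) (c + 1 + b) with hD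
  have hdet : D.det ≠ 0 := h
  let _ : Invertible D := D.invertibleOfIsUnitDet (isUnit_iff_ne_zero.mpr hdet)
  let row (x : ℕ) : Matrix (Fin 1) (Fin m) K := Matrix.of fun _ b => F x (c + 1 + b)
  let col (y : ℕ) : Matrix (Fin m) (Fin 1) K := Matrix.of fun a _ => F (r + 1 + a) y
  let S (x y : ℕ) : K := F x y - (row x * ⅟D * col y) 0 0
  let B (x y : ℕ) : Matrix (Fin 1 ⊕ Fin m) (Fin 1 ⊕ Fin m) K :=
    Matrix.fromBlocks (Matrix.of fun _ _ => F x y) (row x) (col y) D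
  have hB (x y : ℕ) : (B x y).det = D.det * S x y := by
    simp only [B, S]
    rw [Matrix.det_fromBlocks₂₂, Matrix.det_unique (A := _ - _)]
    rfl
  have hfull : contiguousMinor F r c (m + 2) =
      D.det * (S r c * S (r + (m + 1)) (c + (m + 1)) - S r (c + (m + 1)) * S (r + (m + 1)) c) := by
    rw [contiguousMinor, ← Matrix.det_submatrix_equiv_self (equivBoth m)]
    have : (Matrix.of fun a b : Fin (m + 2) => F (r + a) (c + b)).submatrix
        (equivBoth m) (equivBoth m) = Matrix.fromBlocks
          (Matrix.of fun a b : Fin 2 => F (![r, r + (m + 1)] a) (![c, c + (m + 1)] b))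
          (Matrix.of fun (a : Fin 2) (b : Fin m) => F (![r, r + (m + 1)] a) (c + 1 + b))
          (Matrix.of fun (a : Fin m) (b : Fin 2) => F (r + 1 + a) (![c, c + (m + 1)] b)) D := by
      ext (x | x) (y | y)
      · fin_cases x <;> fin_cases y <;> simp [equivBoth, add_assoc]
      · fin_cases x <;> simp [equivBoth, add_comm, add_left_comm]
      · fin_cases y <;> simp [equivBoth, add_comm, add_left_comm]
      · simp [equivBoth, hD, add_comm, add_left_comm]
    rw [this, Matrix.det_fromBlocks₂₂, Matrix.det_fin_two]
    rfl
  have hff : contiguousMinor F r c (m + 1) = D.det * S r c := by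
    rw [contiguousMinor, ← Matrix.det_submatrix_equiv_self (equivFirst m), ← hB]
    congr 1
    ext (x | x) (y | y) <;> simp [equivFirst, B, row, col, hD, add_comm, add_left_comm]
  have hll : contiguousMinor F (r + 1) (c + 1) (m + 1) =
      D.det * S (r + (m + 1)) (c + (m + 1)) := by
    rw [contiguousMinor, ← Matrix.det_submatrix_equiv_self (equivLast m), ← hB]
    congr 1
    ext (x | x) (y | y) <;> simp [equivLast, B, row, col, hD, add_comm, add_left_comm]
  set σ : Equiv.Perm (Fin 1 ⊕ Fin m) := (equivLast m).trans (equivFirst m).symm with hσ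
  have hlf : contiguousMinor F (r + 1) c (m + 1) =
      (Equiv.Perm.sign σ : ℤ) * (D.det * S (r + (m + 1)) c) := by
    rw [contiguousMinor, ← Matrix.det_submatrix_equiv_self (equivFirst m), ← hB]
    have : (Matrix.of fun a b : Fin (m + 1) => F (r + 1 + a) (c + b)).submatrix
        (equivFirst m) (equivFirst m) =
          (B (r + (m + 1)) c).submatrix ⇑(σ⁻¹ : Equiv.Perm (Fin 1 ⊕ Fin m)) id := by
      have h2 : (Matrix.of fun a b : Fin (m + 1) => F (r + 1 + a) (c + b)).submatrix
        (equivLast m) (equivFirst m) = B (r + (m + 1)) c := by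
        ext (x | x) (y | y) <;>
          simp [equivFirst, equivLast, B, row, col, hD, add_comm, add_left_comm]
      rw [← h2]
      ext x y
      simp [hσ, Equiv.Perm.inv_def]
    rw [this, Matrix.det_permute]
    simp
  have hfl : contiguousMinor F r (c + 1) (m + 1) =
      (Equiv.Perm.sign σ : ℤ) * (D.det * S r (c + (m + 1))) := by
    rw [contiguousMinor, ← Matrix.det_submatrix_equiv_self (equivLast m), ← hB]
    have : (Matrix.of fun a b : Fin (m + 1) => F (r + a) (c + 1 + b)).submatrix
        (equivLast m) (equivLast m) = (B r (c + (m + 1))).submatrix σ id := by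
      have h2 : (Matrix.of fun a b : Fin (m + 1) => F (r + a) (c + 1 + b)).submatrix
        (equivFirst m) (equivLast m) = B r (c + (m + 1)) := by
        ext (x | x) (y | y) <;>
          simp [equivFirst, equivLast, B, row, col, hD, add_comm, add_left_comm]
      rw [← h2]
      ext x y
      simp [hσ]
    rw [this, Matrix.det_permute]
  have hs : ((Equiv.Perm.sign σ : ℤ) : K) * ((Equiv.Perm.sign σ : ℤ) : K) = 1 := by
    rcases Int.units_eq_one_or (Equiv.Perm.sign σ) with h | h <;> simp [h]
  have hi : contiguousMinor F (r + 1) (c + 1) m = D.det := rfl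
  rw [hfull, hff, hll, hlf, hfl, hi]
  linear_combination (D.det ^ 2 * S r (c + (m + 1)) * S (r + (m + 1)) c) * hs

/-- Row operation: the letter `i` with parameter `t` adds `t` times row `i - 1` to row `i`. -/
def rowAct {K : Type*} [Field K] (x : ℕ × K) (F : ℕ → ℕ → K) : ℕ → ℕ → K :=
  fun r c => if r = x.1 then F r c + x.2 * F (r - 1) c else F r c

/-- The infinite identity matrix. -/
def idFun (K : Type*) [Field K] : ℕ → ℕ → K := fun r c => if r = c then 1 else 0

/-- The parametrized word with letters `k + l - 1, …, k + 1, k`, letter `k + j` carrying `e j`. -/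
def descWord {K : Type*} : ℕ → ℕ → (ℕ → K) → List (ℕ × K)
  | _, 0, _ => []
  | k, l + 1, e => descWord (k + 1) l (fun j => e (j + 1)) ++ [(k, e 0)]

/-- The parametrized standard reduced word of the longest element on the letters
`k, …, k + l - 1`. -/
def stdWord {K : Type*} : ℕ → ℕ → (ℕ → ℕ → K) → List (ℕ × K)
  | _, 0, _ => []
  | k, l + 1, e => descWord k (l + 1) (e 0) ++ stdWord (k + 1) l (fun j => e (j + 1))

theorem rowAct_descWord {K : Type*} [Field K] (l : ℕ) : ∀ (k : ℕ) (e : ℕ → K)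
    (F : ℕ → ℕ → K), 1 ≤ k →
    (∀ r c, r < k → (descWord k l e).foldr rowAct F r c = F r c) ∧
    ∀ j c, j < l → (descWord k l e).foldr rowAct F (k + j) c =
      F (k + j) c + e j * (descWord k l e).foldr rowAct F (k + j - 1) c := by
  induction l with
  | zero => simp [descWord]
  | succ l ih =>
    intro k e F hk
    obtain ⟨h1, h2⟩ := ih (k + 1) (fun j => e (j + 1)) (rowAct (k, e 0) F) (by omega)
    simp only [descWord, List.foldr_append, List.foldr_cons, List.foldr_nil]
    refine ⟨fun r c hr => ?_, fun j c hj => ?_⟩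
    · rw [h1 r c (by omega), rowAct, if_neg (by dsimp; omega)]
    · cases j with
      | zero =>
        rw [h1 _ c (by omega), h1 _ c (by omega)]
        simp only [rowAct, add_zero, if_true]
        rw [if_neg (by omega)]
      | succ j =>
        have := h2 j c (by omega)
        rw [show k + (j + 1) = k + 1 + j by omega, this, rowAct, if_neg (by dsimp; omega)]

theorem letter_mem_descWord {K : Type*} (l : ℕ) : ∀ (k : ℕ) (e : ℕ → K),
    ∀ x ∈ descWord k l e, k ≤ x.1 := by
  induction l with
  | zero => simp [descWord]
  | succ l ih =>
    intro k e x hx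
    simp only [descWord, List.mem_append, List.mem_singleton] at hx
    rcases hx with hx | rfl
    · have := ih _ _ x hx
      omega
    · exact le_rfl

theorem letter_mem_stdWord {K : Type*} (l : ℕ) : ∀ (k : ℕ) (e : ℕ → ℕ → K),
    ∀ x ∈ stdWord k l e, k ≤ x.1 := by
  induction l with
  | zero => simp [stdWord]
  | succ l ih =>
    intro k e x hx
    simp only [stdWord, List.mem_append] at hx
    rcases hx with hx | hx
    · exact letter_mem_descWord _ _ _ x hx
    · have := ih _ _ x hx
      omega

theorem mem_descWord {K : Type*} (l : ℕ) : ∀ (k : ℕ) (e : ℕ → K) (j : ℕ), j < l →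
    (k + j, e j) ∈ descWord k l e := by
  induction l with
  | zero => intro k e j hj; omega
  | succ l ih =>
    intro k e j hj
    simp only [descWord, List.mem_append, List.mem_singleton]
    cases j with
    | zero => exact Or.inr rfl
    | succ j =>
      left
      have := ih (k + 1) (fun j => e (j + 1)) j (by omega)
      rwa [show k + (j + 1) = k + 1 + j by omega]

theorem mem_stdWord {K : Type*} (l : ℕ) : ∀ (k : ℕ) (e : ℕ → ℕ → K) (a b : ℕ), a + b < l →
    (k + a + b, e a b) ∈ stdWord k l e := by
  induction l with
  | zero => intro k e a b h; omega
  | succ l ih =>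
    intro k e a b h
    simp only [stdWord, List.mem_append]
    cases a with
    | zero => exact Or.inl (mem_descWord _ _ _ _ (by omega))
    | succ a =>
      right
      have := ih (k + 1) (fun j => e (j + 1)) a b (by omega)
      rwa [show k + (a + 1) + b = k + 1 + a + b by omega]

theorem foldr_rowAct_idFun_column {K : Type*} [Field K] (c : ℕ) (L : List (ℕ × K))
    (hL : ∀ x ∈ L, c + 2 ≤ x.1) (r : ℕ) :
    L.foldr rowAct (idFun K) r c = idFun K r c := by
  induction L generalizing r with
  | nil => rfl
  | cons x L ih =>
    have hx := hL x (by simp)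
    have ih' := ih fun y hy => hL y (by simp [hy])
    rw [List.foldr_cons, rowAct]
    split_ifs with h
    · rw [ih', ih']
      simp only [idFun]
      rw [if_neg (show ¬ r - 1 = c by omega)]
      ring
    · exact ih' r

/-- The lower-left contiguous minors of the standard product are products of parameters over
rectangles. -/
theorem contiguousMinor_stdWord {K : Type*} [Field K] (l : ℕ) : ∀ (b : ℕ) (e : ℕ → ℕ → K)
    (k r : ℕ), k + r ≤ l + 1 →
    contiguousMinor ((stdWord (b + 1) l e).foldr rowAct (idFun K)) (b + r) b k =
      ∏ k' ∈ Finset.range k, ∏ r' ∈ Finset.range r, e k' r' := by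
  induction l with
  | zero =>
    intro b e k r h
    rcases Nat.eq_zero_or_pos k with rfl | hk
    · simp [contiguousMinor]
    · obtain ⟨rfl, rfl⟩ : k = 1 ∧ r = 0 := by omega
      simp [contiguousMinor, stdWord, idFun]
  | succ l ih =>
    intro b e k r h
    cases k with
    | zero => simp [contiguousMinor]
    | succ k =>
      simp only [stdWord, List.foldr_append]
      set F := (stdWord (b + 1 + 1) l fun j => e (j + 1)).foldr rowAct (idFun K) with hF
      set R := (descWord (b + 1) (l + 1) (e 0)).foldr rowAct F with hR
      obtain ⟨h1, h2⟩ := rowAct_descWord (l + 1) (b + 1) (e 0) F (by omega)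
      have hcol (x : ℕ) : F x b = idFun K x b :=
        foldr_rowAct_idFun_column b _ (fun y hy => by
          have := letter_mem_stdWord _ _ _ y hy
          omega) x
      have hRcol (x : ℕ) (hx : x ≤ l + 1) : R (b + x) b = ∏ r' ∈ Finset.range x, e 0 r' := by
        induction x with
        | zero =>
          rw [hR, h1 _ _ (by omega), hcol]
          simp [idFun]
        | succ x ihx =>
          have := h2 x b (by omega)
          rw [show b + 1 + x = b + (x + 1) by omega, ← hR, hcol,
            show b + (x + 1) - 1 = b + x by omega, ihx (by omega)] at this
          rw [this, Finset.prod_range_succ, idFun, if_neg (by omega)]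
          ring
      let B : Matrix (Fin (k + 1)) (Fin (k + 1)) K :=
        Matrix.of fun x y => if x = 0 then R (b + r) (b + y) else F (b + r + x) (b + y)
      have hdet : contiguousMinor R (b + r) b (k + 1) = B.det := by
        refine Matrix.det_eq_of_forall_row_eq_smul_add_pred
          (fun x : Fin k => e 0 (r + x)) (fun y => by simp [B]) fun x y => ?_
        have := h2 (r + x) (b + y) (by omega)
        rw [← hR, show b + 1 + (r + x) = b + r + (x + 1) by omega,
          show b + r + (x + 1) - 1 = b + r + x by omega] at this
        simp only [Matrix.of_apply, B, Fin.succ_ne_zero, if_false, Fin.val_succ,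
          Fin.val_castSucc]
        exact this
      rw [hdet, Matrix.det_succ_column_zero, Fin.sum_univ_succ, Finset.sum_eq_zero, add_zero,
        Finset.prod_range_succ', mul_comm]
      · have hB0 : B 0 0 = ∏ r' ∈ Finset.range r, e 0 r' := by
          simp [B, hRcol r (by omega)]
        have := ih (b + 1) (fun j => e (j + 1)) k r (by omega)
        rw [← this, hB0, mul_comm]
        simp only [Fin.val_zero, pow_zero, one_mul]
        rw [mul_comm]
        congr 2
        ext x y
        simp only [B, Matrix.submatrix_apply, Matrix.of_apply, Fin.succAbove_zero,
          Fin.succ_ne_zero, if_false, Fin.val_succ]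
        congr 1 <;> omega
      · intro x _
        have : B x.succ 0 = 0 := by
          simp only [B, Matrix.of_apply, Fin.succ_ne_zero, if_false, Fin.val_zero, add_zero,
            hcol, idFun, Fin.val_succ]
          rw [if_neg (by omega)]
        rw [this]
        ring

/-- A family of nonzero elements closed under the semifield operations on which `v` behaves as a
valuation without cancellation. -/
structure IsPositiveValuation {K : Type*} [Field K] (P : K → Prop) (v : K → ℝ) : Prop where
  ne_zero : ∀ x, P x → x ≠ 0
  add : ∀ x y, P x → P y → P (x + y)
  mul : ∀ x y, P x → P y → P (x * y)
  inv : ∀ x, P x → P x⁻¹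
  one : P 1
  map_add : ∀ x y, P x → P y → v (x + y) = min (v x) (v y)
  map_mul : ∀ x y, P x → P y → v (x * y) = v x + v y
  map_inv : ∀ x, P x → v x⁻¹ = - v x

namespace IsPositiveValuation

variable {K : Type*} [Field K] {P : K → Prop} {v : K → ℝ}

theorem div (h : IsPositiveValuation P v) {x y : K} (hx : P x) (hy : P y) : P (x / y) := by
  rw [div_eq_mul_inv]
  exact h.mul _ _ hx (h.inv _ hy)

theorem map_div (h : IsPositiveValuation P v) {x y : K} (hx : P x) (hy : P y) :
    v (x / y) = v x - v y := by
  rw [div_eq_mul_inv, h.map_mul _ _ hx (h.inv _ hy), h.map_inv _ hy, sub_eq_add_neg]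

theorem map_one (h : IsPositiveValuation P v) : v 1 = 0 := by
  have := h.map_mul 1 1 h.one h.one
  rw [mul_one] at this
  linarith

theorem prod (h : IsPositiveValuation P v) (f : ℕ → K) (k : ℕ) (hf : ∀ j < k, P (f j)) :
    P (∏ j ∈ Finset.range k, f j) ∧
      v (∏ j ∈ Finset.range k, f j) = ∑ j ∈ Finset.range k, v (f j) := by
  induction k with
  | zero => simp [h.one, h.map_one]
  | succ k ih =>
    obtain ⟨h1, h2⟩ := ih fun j hj => hf j (by omega)
    rw [Finset.prod_range_succ, Finset.sum_range_succ, h.map_mul _ _ h1 (hf k (by omega)), h2]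
    exact ⟨h.mul _ _ h1 (hf k (by omega)), rfl⟩

end IsPositiveValuation

/-- The tropical Toda-type equations force the local rule of an ideal filling. -/
theorem tropical_local_rule (n : ℕ) (v : ℕ → ℕ → ℝ)
    (h : ∀ k r, k + r + 2 < n →
      min (∑ t ∈ Finset.range (r + 1), (v (k + 1) t - v k t))
        (∑ t ∈ Finset.range (k + 1), (v t (r + 1) - v t r)) = 0) :
    ∀ k r, k + r + 2 < n → v k r = min (v (k + 1) r) (v k (r + 1)) := by
  suffices H : ∀ s, ∀ k r, k + r = s → k + r + 2 < n → v k r = min (v (k + 1) r) (v k (r + 1)) by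
    intro k r hkr
    exact H _ k r rfl hkr
  intro s
  induction s using Nat.strong_induction_on with
  | _ s ih =>
  -- Lower levels: the partial sums are nonnegative, and vanish in the non-increasing direction.
  have ih' : ∀ k r, k + r < s → k + r + 2 < n → v k r = min (v (k + 1) r) (v k (r + 1)) :=
    fun k r hs hn => ih _ hs k r rfl hn
  have rowNonneg : ∀ k r, k + r ≤ s → s + 2 < n →
      0 ≤ ∑ t ∈ Finset.range r, (v (k + 1) t - v k t) := by
    intro k r hs hn
    refine Finset.sum_nonneg fun t ht => ?_
    rw [Finset.mem_range] at ht
    have := ih' k t (by omega) (by omega)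
    have := min_le_left (v (k + 1) t) (v k (t + 1))
    linarith
  have colNonneg : ∀ k r, k + r ≤ s → s + 2 < n →
      0 ≤ ∑ t ∈ Finset.range k, (v t (r + 1) - v t r) := by
    intro k r hs hn
    refine Finset.sum_nonneg fun t ht => ?_
    rw [Finset.mem_range] at ht
    have := ih' t r (by omega) (by omega)
    have := min_le_right (v (t + 1) r) (v t (r + 1))
    linarith
  have rowZero : ∀ k r, k + r + 1 ≤ s → s + 2 < n → v (k + 1) r ≤ v k (r + 1) →
      ∑ t ∈ Finset.range (r + 1), (v (k + 1) t - v k t) = 0 := by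
    intro k r
    induction r with
    | zero =>
      intro hs hn hle
      rw [Finset.sum_range_one, ih' k 0 (by omega) (by omega), min_eq_left hle, sub_self]
    | succ r ihr =>
      intro hs hn hle
      have h1 := ih' k (r + 1) (by omega) (by omega)
      rw [min_eq_left hle] at h1
      have h2 := ih' (k + 1) r (by omega) (by omega)
      rw [Finset.sum_range_succ, ihr (by omega) hn, h1]
      · ring
      · rw [h1, h2]
        exact min_le_right _ _
  have colZero : ∀ k r, k + r + 1 ≤ s → s + 2 < n → v k (r + 1) ≤ v (k + 1) r →
      ∑ t ∈ Finset.range (k + 1), (v t (r + 1) - v t r) = 0 := by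
    intro k
    induction k with
    | zero =>
      intro r hs hn hle
      rw [Finset.sum_range_one, ih' 0 r (by omega) (by omega), min_eq_right hle, sub_self]
    | succ k ihk =>
      intro r hs hn hle
      have h1 := ih' (k + 1) r (by omega) (by omega)
      rw [min_eq_right hle] at h1
      have h2 := ih' k (r + 1) (by omega) (by omega)
      rw [Finset.sum_range_succ, ihk r (by omega) hn, h1]
      · ring
      · rw [h1, h2]
        exact min_le_left _ _
  have rowGe : ∀ k r, k + r = s → s + 2 < n → v k r ≤ v (k + 1) r := by
    intro k r hs hn
    have hk := h k r (by omega)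
    cases r with
    | zero =>
      have := hk.symm.le.trans (min_le_left _ _)
      rw [Finset.sum_range_one] at this
      linarith
    | succ r =>
      rcases le_total (v (k + 1) r) (v k (r + 1)) with hle | hle
      · have := hk.symm.le.trans (min_le_left _ _)
        rw [Finset.sum_range_succ, rowZero k r (by omega) hn hle] at this
        linarith
      · have h' := (h (k + 1) r (by omega)).symm.le.trans (min_le_right _ _)
        rw [Finset.sum_range_succ, colZero k r (by omega) hn hle] at h'
        linarith
  have colGe : ∀ k r, k + r = s → s + 2 < n → v k r ≤ v k (r + 1) := by
    intro k r hs hn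
    have hk := h k r (by omega)
    cases k with
    | zero =>
      have := hk.symm.le.trans (min_le_right _ _)
      rw [Finset.sum_range_one] at this
      linarith
    | succ k =>
      rcases le_total (v k (r + 1)) (v (k + 1) r) with hle | hle
      · have := hk.symm.le.trans (min_le_right _ _)
        rw [Finset.sum_range_succ, colZero k r (by omega) hn hle] at this
        linarith
      · have h' := (h k (r + 1) (by omega)).symm.le.trans (min_le_left _ _)
        rw [Finset.sum_range_succ, rowZero k r (by omega) hn hle] at h'
        linarith
  intro k r hs hn
  have h1 := rowGe k r hs (by omega)
  have h2 := colGe k r hs (by omega)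
  have h3 := rowNonneg k r hs.le (by omega)
  have h4 := colNonneg k r hs.le (by omega)
  have h5 := h k r hn
  rw [Finset.sum_range_succ, Finset.sum_range_succ] at h5
  refine le_antisymm (le_min h1 h2) ?_
  rcases min_choice (∑ t ∈ Finset.range r, (v (k + 1) t - v k t) + (v (k + 1) r - v k r))
    (∑ t ∈ Finset.range k, (v t (r + 1) - v t r) + (v k (r + 1) - v k r)) with h6 | h6
  · exact (min_le_left _ _).trans (by linarith)
  · exact (min_le_right _ _).trans (by linarith)

/-- For a Toeplitz standard product with positive parameters, the valuations satisfy the local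
rule. -/
theorem stdWord_local_rule {K : Type*} [Field K] {P : K → Prop} {v : K → ℝ}
    (hP : IsPositiveValuation P v) (l : ℕ) (e : ℕ → ℕ → K)
    (hpos : ∀ k r, k + r < l → P (e k r))
    (hT : ∀ r c, r + 1 < l + 1 → c + 1 < l + 1 →
      (stdWord 1 l e).foldr rowAct (idFun K) r c =
        (stdWord 1 l e).foldr rowAct (idFun K) (r + 1) (c + 1)) :
    ∀ k r, k + r + 2 < l + 1 → v (e k r) = min (v (e (k + 1) r)) (v (e k (r + 1))) := by
  set R := (stdWord 1 l e).foldr rowAct (idFun K) with hR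
  have hD (k r : ℕ) (h : k + r ≤ l + 1) : contiguousMinor R r 0 k =
      ∏ k' ∈ Finset.range k, ∏ r' ∈ Finset.range r, e k' r' := by
    have := contiguousMinor_stdWord l 0 e k r h
    simpa only [zero_add] using this
  have hDpos (k r : ℕ) (h : k + r ≤ l + 1) : P (contiguousMinor R r 0 k) ∧
      v (contiguousMinor R r 0 k) =
        ∑ k' ∈ Finset.range k, ∑ r' ∈ Finset.range r, v (e k' r') := by
    rw [hD k r h]
    have h1 (k' : ℕ) (hk' : k' < k) := hP.prod (e k') r fun r' hr' => hpos k' r' (by omega)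
    have h2 := hP.prod (fun k' => ∏ r' ∈ Finset.range r, e k' r') k fun k' hk' => (h1 k' hk').1
    exact ⟨h2.1, h2.2.trans
      (Finset.sum_congr rfl fun k' hk' => (h1 k' (Finset.mem_range.mp hk')).2)⟩
  have hshift (k r : ℕ) (h : k + r ≤ l) :
      contiguousMinor R (r + 1) 1 k = contiguousMinor R r 0 k := by
    unfold contiguousMinor
    congr 1
    ext x y
    have := hT (r + x) (0 + y) (by omega) (by omega)
    simp only [Matrix.of_apply, this]
    congr 1 <;> omega
  refine tropical_local_rule (l + 1) (fun k r => v (e k r)) fun k r hkr => ?_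
  have p1 := hDpos (k + 2) (r + 1) (by omega)
  have p2 := hDpos k (r + 1) (by omega)
  have p3 := hDpos (k + 1) (r + 1) (by omega)
  have p4 := hDpos (k + 1) (r + 2) (by omega)
  have p5 := hDpos (k + 1) r (by omega)
  have hJ := contiguousMinor_desnanot_jacobi R (r + 1) 0 k (by
    rw [zero_add, hshift k (r + 1) (by omega)]
    exact hP.ne_zero _ p2.1)
  rw [zero_add, hshift k (r + 1) (by omega), hshift (k + 1) (r + 1) (by omega),
    hshift (k + 1) r (by omega)] at hJ
  have hJ' := congrArg v (eq_sub_iff_add_eq.mp hJ)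
  rw [hP.map_add _ _ (hP.mul _ _ p1.1 p2.1) (hP.mul _ _ p4.1 p5.1), hP.map_mul _ _ p1.1 p2.1,
    hP.map_mul _ _ p4.1 p5.1, hP.map_mul _ _ p3.1 p3.1, p1.2, p2.2, p3.2, p4.2, p5.2] at hJ'
  simp only [Finset.sum_range_succ _ (k + 1), Finset.sum_range_succ _ k,
    Finset.sum_range_succ _ (r + 1), Finset.sum_range_succ _ r, Finset.sum_add_distrib] at hJ'
  simp only [Finset.sum_sub_distrib, Finset.sum_range_succ _ k, Finset.sum_range_succ _ r]
  rw [min_def] at hJ' ⊢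
  split_ifs at hJ' ⊢ <;> linarith

/-- The simple transposition `(i, i + 1)` of `ℕ`. -/
def natSwap (i : ℕ) : Equiv.Perm ℕ := Equiv.swap i (i + 1)

/-- The permutation of `ℕ` represented by a word. -/
def wordPerm (x : List ℕ) : Equiv.Perm ℕ := (x.map natSwap).prod

/-- A word is reduced if it has minimal length among all words for its permutation. -/
def IsReducedWord (x : List ℕ) : Prop := ∀ y, wordPerm y = wordPerm x → x.length ≤ y.length

theorem natSwap_mul_self (i : ℕ) : natSwap i * natSwap i = 1 := Equiv.swap_mul_self _ _

theorem natSwap_inv (i : ℕ) : (natSwap i)⁻¹ = natSwap i := Equiv.swap_inv _ _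

theorem natSwap_apply (i x : ℕ) :
    natSwap i x = if x = i then i + 1 else if x = i + 1 then i else x :=
  Equiv.swap_apply_def _ _ _

theorem wordPerm_nil : wordPerm [] = 1 := rfl

theorem wordPerm_cons (i : ℕ) (x : List ℕ) : wordPerm (i :: x) = natSwap i * wordPerm x := by
  simp [wordPerm]

theorem wordPerm_append (x y : List ℕ) : wordPerm (x ++ y) = wordPerm x * wordPerm y := by
  simp [wordPerm]

theorem natSwap_comm {i j : ℕ} (h : i + 2 ≤ j ∨ j + 2 ≤ i) :
    natSwap i * natSwap j = natSwap j * natSwap i := by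
  ext x
  simp only [Equiv.Perm.mul_apply, natSwap_apply]
  grind

theorem natSwap_braid {i j : ℕ} (h : j = i + 1 ∨ i = j + 1) :
    natSwap i * natSwap j * natSwap i = natSwap j * natSwap i * natSwap j := by
  ext x
  simp only [Equiv.Perm.mul_apply, natSwap_apply]
  grind

/-- Every inversion of `wordPerm x` is one of the roots attached to `x`. -/
theorem exists_root_of_inversion (x : List ℕ) : ∀ p q : ℕ, p < q →
    (wordPerm x)⁻¹ q < (wordPerm x)⁻¹ p →
    ∃ (j : ℕ) (h : j < x.length), wordPerm (x.take j) x[j] = p ∧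
      wordPerm (x.take j) (x[j] + 1) = q := by
  induction x with
  | nil =>
    intro p q hpq h
    simp [wordPerm] at h
    omega
  | cons i x ih =>
    intro p q hpq h
    rw [wordPerm_cons, _root_.mul_inv_rev, natSwap_inv, Equiv.Perm.mul_apply,
      Equiv.Perm.mul_apply] at h
    have hself (y : ℕ) : natSwap i (natSwap i y) = y := by
      rw [← Equiv.Perm.mul_apply, natSwap_mul_self, Equiv.Perm.one_apply]
    by_cases hlt : natSwap i p < natSwap i q
    · obtain ⟨j, hj, h1, h2⟩ := ih _ _ hlt h
      refine ⟨j + 1, by simpa using hj, ?_, ?_⟩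
      · simp [wordPerm_cons, h1, hself]
      · simp [wordPerm_cons, h2, hself]
    · refine ⟨0, by simp, ?_⟩
      simp only [natSwap_apply] at hlt
      simp only [List.take_zero, wordPerm_nil, List.getElem_cons_zero, Equiv.Perm.one_apply]
      grind

/-- The exchange property. -/
theorem exists_exchange (x : List ℕ) : ∀ p q : ℕ, p < q →
    (wordPerm x)⁻¹ q < (wordPerm x)⁻¹ p →
    ∃ y : List ℕ, y.length + 1 = x.length ∧ Equiv.swap p q * wordPerm x = wordPerm y := by
  induction x with
  | nil =>
    intro p q hpq h
    simp [wordPerm] at h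
    omega
  | cons i x ih =>
    intro p q hpq h
    rw [wordPerm_cons, _root_.mul_inv_rev, natSwap_inv, Equiv.Perm.mul_apply,
      Equiv.Perm.mul_apply] at h
    by_cases hlt : natSwap i p < natSwap i q
    · obtain ⟨y, hy, h1⟩ := ih _ _ hlt h
      refine ⟨i :: y, by simpa using hy, ?_⟩
      rw [wordPerm_cons, wordPerm_cons, ← h1, Equiv.swap_apply_apply, natSwap_inv,
        ← mul_assoc, ← mul_assoc, ← mul_assoc, ← mul_assoc, natSwap_mul_self, one_mul]
    · obtain ⟨rfl, rfl⟩ : p = i ∧ q = i + 1 := by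
        simp only [natSwap_apply] at hlt
        grind
      exact ⟨x, by simp, by
        rw [wordPerm_cons, ← mul_assoc, show Equiv.swap p (p + 1) = natSwap p from rfl,
          natSwap_mul_self, one_mul]⟩

theorem IsReducedWord.tail {i : ℕ} {x : List ℕ} (h : IsReducedWord (i :: x)) :
    IsReducedWord x := by
  intro y hy
  have := h (i :: y) (by rw [wordPerm_cons, wordPerm_cons, hy])
  simpa using this

theorem IsReducedWord.of_length_le {x y : List ℕ} (h : IsReducedWord x)
    (hp : wordPerm x = wordPerm y) (hl : y.length ≤ x.length) : IsReducedWord y :=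
  fun z hz => hl.trans (h z (hz.trans hp.symm))

/-- The first letter of a reduced word is a left descent. -/
theorem IsReducedWord.descent {j : ℕ} {y : List ℕ} (h : IsReducedWord (j :: y)) :
    (wordPerm (j :: y))⁻¹ (j + 1) < (wordPerm (j :: y))⁻¹ j := by
  by_contra hlt
  rw [wordPerm_cons, _root_.mul_inv_rev, natSwap_inv, Equiv.Perm.mul_apply,
    Equiv.Perm.mul_apply] at hlt
  simp only [natSwap_apply] at hlt
  have hne : (wordPerm y)⁻¹ j ≠ (wordPerm y)⁻¹ (j + 1) := by simp
  obtain ⟨z, hz, h1⟩ := exists_exchange y j (j + 1) (by omega) (by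
    simp only [if_true, Nat.succ_ne_self, if_false] at hlt
    omega)
  have := h z (by rw [← h1, wordPerm_cons]; rfl)
  simp only [List.length_cons] at this
  omega

/-- Two words are related by commutation and braid moves, carrying the parameters along. -/
inductive BraidRel {K : Type*} [Field K] : List (ℕ × K) → List (ℕ × K) → Prop
  | refl (L) : BraidRel L L
  | trans {L₁ L₂ L₃} : BraidRel L₁ L₂ → BraidRel L₂ L₃ → BraidRel L₁ L₃
  | cons (x) {L₁ L₂} : BraidRel L₁ L₂ → BraidRel (x :: L₁) (x :: L₂)
  | comm (i j : ℕ) (a b : K) (L) : (i + 2 ≤ j ∨ j + 2 ≤ i) →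
      BraidRel ((i, a) :: (j, b) :: L) ((j, b) :: (i, a) :: L)
  | braid (i j : ℕ) (a b c : K) (L) : (j = i + 1 ∨ i = j + 1) →
      BraidRel ((i, a) :: (j, b) :: (i, c) :: L)
        ((j, b * c / (a + c)) :: (i, a + c) :: (j, a * b / (a + c)) :: L)

/-- The Matsumoto–Tits property: reduced words of the same permutation are connected by
commutation and braid moves. -/
theorem exists_braidRel {K : Type*} [Field K] : ∀ (l : ℕ) (L : List (ℕ × K)) (y : List ℕ),
    L.length = l → IsReducedWord (L.map Prod.fst) → IsReducedWord y →
    wordPerm (L.map Prod.fst) = wordPerm y → ∃ L', L'.map Prod.fst = y ∧ BraidRel L L' := by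
  intro l
  induction l with
  | zero =>
    intro L y hl hL hy hp
    obtain rfl := List.length_eq_zero_iff.mp hl
    have := hy [] (by simpa using hp)
    obtain rfl : y = [] := by simpa using this
    exact ⟨[], rfl, .refl _⟩
  | succ l ih =>
    intro L y hl hL hy hp
    obtain _ | ⟨⟨i, t⟩, X⟩ := L
    · simp at hl
    have hlen : y.length = l + 1 := by
      have h1 := hy _ hp
      have h2 := hL _ hp.symm
      rw [List.length_map, hl] at h1 h2
      omega
    obtain _ | ⟨j, y⟩ := y
    · simp at hlen
    simp only [List.length_cons, Nat.add_right_cancel_iff] at hl hlen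
    simp only [List.map_cons] at hL hp ⊢
    set x := X.map Prod.fst with hx
    have hxl : x.length = l := by rw [hx, List.length_map, hl]
    have hdi := hL.descent
    have hdj := hy.descent
    rw [← hp] at hdj
    have hw : wordPerm (i :: x) = natSwap i * wordPerm x := wordPerm_cons _ _
    have hu : wordPerm x = natSwap i * wordPerm (i :: x) := by
      rw [hw, ← mul_assoc, natSwap_mul_self, one_mul]
    have hv : wordPerm y = natSwap j * wordPerm (i :: x) := by
      rw [hp, wordPerm_cons, ← mul_assoc, natSwap_mul_self, one_mul]
    set w := wordPerm (i :: x) with hwdef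
    rcases eq_or_ne i j with rfl | hij
    · obtain ⟨L', h1, h2⟩ := ih X y hl hL.tail hy.tail (by rw [← hx, hu, hv])
      exact ⟨(i, t) :: L', by simp [h1], .cons _ h2⟩
    by_cases hfar : i + 2 ≤ j ∨ j + 2 ≤ i
    · obtain ⟨z, hz, hzp⟩ := exists_exchange x j (j + 1) (by omega) (by
        simp only [hu, _root_.mul_inv_rev, natSwap_inv, Equiv.Perm.mul_apply]
        rw [natSwap_apply, natSwap_apply]
        grind)
      change natSwap j * _ = _ at hzp
      have hz1 : wordPerm (j :: z) = wordPerm x := by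
        rw [wordPerm_cons, ← hzp, ← mul_assoc, natSwap_mul_self, one_mul]
      have hz2 : wordPerm (i :: z) = wordPerm y := by
        rw [wordPerm_cons, ← hzp, hu, hv, ← mul_assoc, ← mul_assoc, natSwap_comm hfar,
          mul_assoc (natSwap j), natSwap_mul_self, mul_one]
      obtain ⟨L₁, h1, h2⟩ := ih X (j :: z) hl hL.tail
        (hL.tail.of_length_le hz1.symm (by simp only [List.length_cons]; omega)) hz1.symm
      obtain _ | ⟨⟨j', a⟩, Z⟩ := L₁
      · simp at h1
      simp only [List.map_cons, List.cons.injEq] at h1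
      obtain ⟨rfl, rfl⟩ := h1
      obtain ⟨L₂, h3, h4⟩ := ih ((i, t) :: Z) y
        (by simp only [List.length_cons, List.length_map] at hz ⊢; omega)
        (hy.tail.of_length_le hz2.symm
          (by simp only [List.map_cons, List.length_cons]; omega)) hy.tail hz2
      exact ⟨(j', a) :: L₂, by simp [h3],
        .trans (.cons _ h2) (.trans (.comm _ _ _ _ _ hfar) (.cons _ h4))⟩
    · have hnear : j = i + 1 ∨ i = j + 1 := by omega
      obtain ⟨z₁, hz₁, hzp₁⟩ := exists_exchange x j (j + 1) (by omega) (by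
        simp only [hu, _root_.mul_inv_rev, natSwap_inv, Equiv.Perm.mul_apply]
        rw [natSwap_apply, natSwap_apply]
        grind)
      change natSwap j * _ = _ at hzp₁
      obtain ⟨z, hz, hzp⟩ := exists_exchange z₁ i (i + 1) (by omega) (by
        simp only [← hzp₁, hu, _root_.mul_inv_rev, natSwap_inv, Equiv.Perm.mul_apply]
        simp only [natSwap_apply]
        grind)
      change natSwap i * _ = _ at hzp
      have hz1 : wordPerm (j :: i :: z) = wordPerm x := by
        rw [wordPerm_cons, wordPerm_cons, ← hzp, ← mul_assoc (natSwap i), natSwap_mul_self,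
          one_mul, ← hzp₁, ← mul_assoc, natSwap_mul_self, one_mul]
      have hz2 : wordPerm (i :: j :: z) = wordPerm y := by
        have hb := natSwap_braid hnear
        rw [wordPerm_cons, wordPerm_cons, ← hzp, ← hzp₁, hu, hv]
        simp only [← mul_assoc]
        rw [hb, mul_assoc (natSwap j * natSwap i), natSwap_mul_self, mul_one,
          mul_assoc (natSwap j), natSwap_mul_self, mul_one]
      obtain ⟨L₁, h1, h2⟩ := ih X (j :: i :: z) hl hL.tail
        (hL.tail.of_length_le hz1.symm (by simp only [List.length_cons]; omega)) hz1.symm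
      obtain _ | ⟨⟨j', a⟩, _ | ⟨⟨i', b⟩, Z⟩⟩ := L₁
      · simp at h1
      · simp at h1
      simp only [List.map_cons, List.cons.injEq] at h1
      obtain ⟨rfl, rfl, rfl⟩ := h1
      obtain ⟨L₂, h3, h4⟩ := ih ((i', t + b) :: (j', t * a / (t + b)) :: Z) y
        (by simp only [List.length_cons, List.length_map] at hz hz₁ ⊢; omega)
        (hy.tail.of_length_le hz2.symm
          (by simp only [List.map_cons, List.length_cons]; omega)) hy.tail hz2
      exact ⟨(j', a * b / (t + b)) :: L₂, by simp [h3],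
        .trans (.cons _ h2) (.trans (.braid _ _ _ _ _ _ hnear) (.cons _ h4))⟩

/-- The valuations of the parameters are given by `f` on the associated roots, which are
positive with entries in `{1, …, n}`; `σ` is the permutation of the preceding word. -/
def HasRootVal {K : Type*} (v : K → ℝ) (n : ℕ) (f : ℕ → ℕ → ℝ) :
    Equiv.Perm ℕ → List (ℕ × K) → Prop
  | _, [] => True
  | σ, x :: L => (1 ≤ σ x.1 ∧ σ x.1 < σ (x.1 + 1) ∧ σ (x.1 + 1) ≤ n ∧
      v x.2 = f (σ x.1) (σ (x.1 + 1))) ∧ HasRootVal v n f (σ * natSwap x.1) L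

theorem BraidRel.transfer {K : Type*} [Field K] {P : K → Prop} {v : K → ℝ}
    (hP : IsPositiveValuation P v) {n : ℕ} {f : ℕ → ℕ → ℝ}
    (hf : ∀ p q r, 1 ≤ p → p < q → q < r → r ≤ n → f p r = min (f p q) (f q r))
    {L L' : List (ℕ × K)} (h : BraidRel L L') (hL : ∀ x ∈ L, 1 ≤ x.1 ∧ P x.2) :
    (∀ x ∈ L', 1 ≤ x.1 ∧ P x.2) ∧ (∀ F, L.foldr rowAct F = L'.foldr rowAct F) ∧
      ∀ σ, HasRootVal v n f σ L' → HasRootVal v n f σ L := by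
  induction h with
  | refl L => exact ⟨hL, fun _ => rfl, fun _ h => h⟩
  | trans _ _ ih₁ ih₂ =>
    obtain ⟨a1, a2, a3⟩ := ih₁ hL
    obtain ⟨b1, b2, b3⟩ := ih₂ a1
    exact ⟨b1, fun F => (a2 F).trans (b2 F), fun σ h => a3 σ (b3 σ h)⟩
  | cons x _ ih =>
    obtain ⟨a1, a2, a3⟩ := ih fun y hy => hL y (by simp [hy])
    refine ⟨fun y hy => ?_, fun F => by simp [a2 F], fun σ h => ⟨h.1, a3 _ h.2⟩⟩
    rcases List.mem_cons.mp hy with rfl | hy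
    · exact hL _ (by simp)
    · exact a1 y hy
  | comm i j a b L hij =>
    have hi := hL (i, a) (by simp)
    have hj := hL (j, b) (by simp)
    refine ⟨fun y hy => hL y (by simp at hy ⊢; tauto), fun F => ?_, fun σ h => ?_⟩
    · simp only [List.foldr_cons]
      ext r c
      simp only [rowAct]
      grind
    · obtain ⟨h1, h2, h3⟩ := h
      simp only [HasRootVal, Equiv.Perm.mul_apply, natSwap_apply] at h1 h2 ⊢
      rw [mul_assoc, natSwap_comm hij, ← mul_assoc]
      refine ⟨?_, ?_, h3⟩ <;> grind
  | braid i j a b c L hij =>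
    have hi := hL (i, a) (by simp)
    have hj := hL (j, b) (by simp)
    have hk := hL (i, c) (by simp)
    have hac : P (a + c) := hP.add _ _ hi.2 hk.2
    have hbc : P (b * c) := hP.mul _ _ hj.2 hk.2
    have hab : P (a * b) := hP.mul _ _ hi.2 hj.2
    have hne : a + c ≠ 0 := hP.ne_zero _ hac
    refine ⟨fun y hy => ?_, fun F => ?_, fun σ h => ?_⟩
    · simp only [List.mem_cons] at hy
      rcases hy with rfl | rfl | rfl | hy
      · exact ⟨hj.1, hP.div hbc hac⟩
      · exact ⟨hi.1, hac⟩
      · exact ⟨hj.1, hP.div hab hac⟩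
      · exact hL y (by simp [hy])
    · simp only [List.foldr_cons]
      generalize L.foldr rowAct F = G
      have hi1 := hi.1
      have hj1 := hj.1
      dsimp only at hi1 hj1
      ext r s
      simp only [rowAct]
      rcases hij with rfl | rfl
      · rcases eq_or_ne r i with rfl | h1
        · simp
          grind
        · rcases eq_or_ne r (i + 1) with rfl | h2
          · simp
            grind
          · simp [h1, h2]
      · rcases eq_or_ne r j with rfl | h1
        · simp
          grind
        · rcases eq_or_ne r (j + 1) with rfl | h2
          · simp
            grind
          · simp [h1, h2]
    · obtain ⟨h1, h2, h3, h4⟩ := h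
      have hb : σ * natSwap i * natSwap j * natSwap i = σ * natSwap j * natSwap i * natSwap j := by
        have := natSwap_braid hij
        simp only [mul_assoc] at this ⊢
        rw [this]
      simp only [HasRootVal] at h1 h2 h3 ⊢
      rw [hb]
      rw [hP.map_div hbc hac, hP.map_mul _ _ hj.2 hk.2] at h1
      rw [hP.map_div hab hac, hP.map_mul _ _ hi.2 hj.2] at h3
      rw [hP.map_add _ _ hi.2 hk.2] at h1 h2 h3
      rcases hij with rfl | rfl
      · simp [Equiv.Perm.mul_apply, natSwap_apply] at h1 h2 h3 ⊢
        have := hf (σ i) (σ (i + 1)) (σ (i + 1 + 1))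
        grind
      · simp [Equiv.Perm.mul_apply, natSwap_apply] at h1 h2 h3 ⊢
        have := hf (σ j) (σ (j + 1)) (σ (j + 1 + 1))
        grind

theorem hasRootVal_append {K : Type*} {v : K → ℝ} {n : ℕ} {f : ℕ → ℕ → ℝ} (A B : List (ℕ × K)) :
    ∀ σ : Equiv.Perm ℕ, HasRootVal v n f σ (A ++ B) ↔
      HasRootVal v n f σ A ∧ HasRootVal v n f (σ * wordPerm (A.map Prod.fst)) B := by
  induction A with
  | nil => simp [HasRootVal, wordPerm_nil]
  | cons x A ih =>
    intro σ
    simp only [List.cons_append, HasRootVal, ih, List.map_cons, wordPerm_cons, mul_assoc, and_assoc]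

theorem wordPerm_descWord {K : Type*} (l : ℕ) : ∀ (k : ℕ) (e : ℕ → K) (x : ℕ),
    wordPerm ((descWord k l e).map Prod.fst) x =
      if x = k then k + l else if k < x ∧ x ≤ k + l then x - 1 else x := by
  induction l with
  | zero =>
    intro k e x
    simp only [descWord, List.map_nil, wordPerm_nil, Equiv.Perm.one_apply]
    grind
  | succ l ih =>
    intro k e x
    simp only [descWord, List.map_append, List.map_cons, List.map_nil, wordPerm_append,
      wordPerm_cons, wordPerm_nil, mul_one, Equiv.Perm.mul_apply, ih, natSwap_apply]
    grind

theorem wordPerm_stdWord {K : Type*} (l : ℕ) : ∀ (k : ℕ) (e : ℕ → ℕ → K) (x : ℕ),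
    wordPerm ((stdWord k l e).map Prod.fst) x =
      if k ≤ x ∧ x ≤ k + l then k + l - (x - k) else x := by
  induction l with
  | zero =>
    intro k e x
    simp only [stdWord, List.map_nil, wordPerm_nil, Equiv.Perm.one_apply]
    grind
  | succ l ih =>
    intro k e x
    simp only [stdWord, List.map_append, wordPerm_append, Equiv.Perm.mul_apply, ih,
      wordPerm_descWord]
    grind

theorem length_descWord {K : Type*} (l : ℕ) : ∀ (k : ℕ) (e : ℕ → K),
    (descWord k l e).length = l := by
  induction l with
  | zero => simp [descWord]
  | succ l ih => simp [descWord, ih]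

theorem length_stdWord {K : Type*} (l : ℕ) : ∀ (k : ℕ) (e : ℕ → ℕ → K),
    (stdWord k l e).length = ∑ j ∈ Finset.range (l + 1), j := by
  induction l with
  | zero => simp [stdWord]
  | succ l ih =>
    intro k e
    rw [Finset.sum_range_succ, stdWord, List.length_append, ih, length_descWord, add_comm]

/-- Every parametrization of the letters of `descWord` is given by some family of parameters. -/
theorem exists_eq_descWord {K : Type*} (l : ℕ) : ∀ (k : ℕ) (e₀ : ℕ → K) (L : List (ℕ × K)),
    L.map Prod.fst = (descWord k l e₀).map Prod.fst → ∃ e, L = descWord k l e := by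
  induction l with
  | zero =>
    intro k e₀ L h
    exact ⟨e₀, by simpa [descWord] using h⟩
  | succ l ih =>
    intro k e₀ L h
    rw [descWord, List.map_append, List.map_eq_append_iff] at h
    obtain ⟨A, B, rfl, hA, hB⟩ := h
    obtain ⟨e, rfl⟩ := ih _ _ _ hA
    obtain ⟨⟨i, a⟩, rfl, hi⟩ := List.map_eq_singleton_iff.mp hB
    obtain rfl : i = k := hi
    exact ⟨fun j => Nat.casesOn j a e, rfl⟩

/-- Every parametrization of the letters of `stdWord` is given by some family of parameters. -/
theorem exists_eq_stdWord {K : Type*} (l : ℕ) : ∀ (k : ℕ) (e₀ : ℕ → ℕ → K) (L : List (ℕ × K)),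
    L.map Prod.fst = (stdWord k l e₀).map Prod.fst → ∃ e, L = stdWord k l e := by
  induction l with
  | zero =>
    intro k e₀ L h
    exact ⟨e₀, by simpa [stdWord] using h⟩
  | succ l ih =>
    intro k e₀ L h
    rw [stdWord, List.map_append, List.map_eq_append_iff] at h
    obtain ⟨A, B, rfl, hA, hB⟩ := h
    obtain ⟨e, rfl⟩ := exists_eq_descWord _ _ _ _ hA
    obtain ⟨e', rfl⟩ := ih _ _ _ hB
    exact ⟨fun j => Nat.casesOn j e e', rfl⟩

theorem hasRootVal_descWord {K : Type*} {v : K → ℝ} {n : ℕ} {f : ℕ → ℕ → ℝ} (l : ℕ) :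
    ∀ (k : ℕ) (e : ℕ → K) (σ : Equiv.Perm ℕ),
    (∀ j < l, 1 ≤ σ (k + j) ∧ σ (k + j) < σ (k + l) ∧ σ (k + l) ≤ n ∧
      v (e j) = f (σ (k + j)) (σ (k + l))) →
    HasRootVal v n f σ (descWord k l e) := by
  induction l with
  | zero => intro k e σ h; trivial
  | succ l ih =>
    intro k e σ h
    rw [descWord, hasRootVal_append]
    refine ⟨ih _ _ _ fun j hj => ?_, ?_, trivial⟩
    · have := h (j + 1) (by omega)
      rwa [show k + (j + 1) = k + 1 + j by ring, show k + (l + 1) = k + 1 + l by ring] at this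
    · have := h 0 (by omega)
      simp only [Equiv.Perm.mul_apply, wordPerm_descWord]
      grind

theorem hasRootVal_stdWord {K : Type*} {v : K → ℝ} {n : ℕ} {f : ℕ → ℕ → ℝ} (l : ℕ) :
    ∀ (k : ℕ) (e : ℕ → ℕ → K) (σ : Equiv.Perm ℕ), l + 1 ≤ n →
    (∀ j ≤ l, σ (k + j) = j + 1) →
    (∀ a b, a + b < l → v (e a b) = f (b + 1) (l + 1 - a)) →
    HasRootVal v n f σ (stdWord k l e) := by
  induction l with
  | zero => intro k e σ _ _ _; trivial
  | succ l ih =>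
    intro k e σ hl hσ hf
    rw [stdWord, hasRootVal_append]
    refine ⟨hasRootVal_descWord _ _ _ _ fun j hj => ?_,
      ih _ _ _ (by omega) (fun j hj => ?_) fun a b h => ?_⟩
    · rw [hσ j (by omega), hσ _ le_rfl, hf 0 j (by omega)]
      exact ⟨by omega, by omega, by omega, rfl⟩
    · rw [Equiv.Perm.mul_apply, wordPerm_descWord, ← hσ j (by omega)]
      grind
    · rw [hf (a + 1) b (by omega), show l + 1 + 1 - (a + 1) = l + 1 - a by omega]

theorem HasRootVal.getElem {K : Type*} {v : K → ℝ} {n : ℕ} {f : ℕ → ℕ → ℝ} (L : List (ℕ × K)) :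
    ∀ (σ : Equiv.Perm ℕ), HasRootVal v n f σ L → ∀ (j : ℕ) (h : j < L.length),
    v L[j].2 = f ((σ * wordPerm ((L.take j).map Prod.fst)) L[j].1)
      ((σ * wordPerm ((L.take j).map Prod.fst)) (L[j].1 + 1)) := by
  induction L with
  | nil => intro σ _ j h; simp at h
  | cons x L ih =>
    intro σ h j hj
    cases j with
    | zero => simpa [wordPerm_nil] using h.1.2.2.2
    | succ j =>
      have := ih _ h.2 j (by simpa using hj)
      simpa only [List.getElem_cons_succ, List.take_succ_cons, List.map_cons, wordPerm_cons,
        mul_assoc] using this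

/-- A word reversing `{1, …, n}` has at least `n (n - 1) / 2` letters. -/
theorem sum_range_le_length_of_reverse (n : ℕ) (x : List ℕ)
    (h : ∀ p, 1 ≤ p → p ≤ n → wordPerm x p = n + 1 - p) :
    ∑ j ∈ Finset.range n, j ≤ x.length := by
  have hinv (p : ℕ) (h1 : 1 ≤ p) (h2 : p ≤ n) : (wordPerm x)⁻¹ p = n + 1 - p := by
    rw [Equiv.Perm.inv_eq_iff_eq, h _ (by omega) (by omega)]
    omega
  have hroot (s : (q : Fin n) × Fin q) : ∃ (j : ℕ) (hj : j < x.length),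
      wordPerm (x.take j) x[j] = (s.2 : ℕ) + 1 ∧
      wordPerm (x.take j) (x[j] + 1) = (s.1 : ℕ) + 1 := by
    have h1 := s.1.isLt
    have h2 := s.2.isLt
    refine exists_root_of_inversion x _ _ (by omega) ?_
    rw [hinv _ (by omega) (by omega), hinv _ (by omega) (by omega)]
    omega
  choose g hg h1 h2 using hroot
  have hinj : Function.Injective (fun s => (⟨g s, hg s⟩ : Fin x.length)) := by
    rintro ⟨⟨q, hq⟩, ⟨p, hp⟩⟩ ⟨⟨q', hq'⟩, ⟨p', hp'⟩⟩ hst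
    have hst' := congrArg Fin.val hst
    have a1 := h1 ⟨⟨q, hq⟩, ⟨p, hp⟩⟩
    have a2 := h2 ⟨⟨q, hq⟩, ⟨p, hp⟩⟩
    have b1 := h1 ⟨⟨q', hq'⟩, ⟨p', hp'⟩⟩
    have b2 := h2 ⟨⟨q', hq'⟩, ⟨p', hp'⟩⟩
    dsimp only at hst'
    simp only [hst'] at a1 a2
    rw [b1] at a1
    rw [b2] at a2
    obtain rfl : p = p' := by simpa using a1.symm
    obtain rfl : q = q' := by simpa using a2.symm
    rfl
  have := Fintype.card_le_of_injective _ hinj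
  simpa [Fintype.card_sigma, Fin.sum_univ_eq_sum_range (fun j => j)] using this

theorem isReducedWord_of_reverse {n : ℕ} {x : List ℕ}
    (h : ∀ p, 1 ≤ p → p ≤ n → wordPerm x p = n + 1 - p)
    (hl : x.length ≤ ∑ j ∈ Finset.range n, j) : IsReducedWord x :=
  fun y hy => hl.trans (sum_range_le_length_of_reverse n y fun p h1 h2 => by rw [hy, h p h1 h2])

/-- The local minimum rule turns into a decomposition rule for `f`. -/
theorem eq_min_of_local_rule (n : ℕ) (f : ℕ → ℕ → ℝ)
    (h : ∀ p q, 1 ≤ p → p + 2 ≤ q → q ≤ n → f p q = min (f (p + 1) q) (f p (q - 1))) :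
    ∀ d p q r, r - p = d → 1 ≤ p → p < q → q < r → r ≤ n → f p r = min (f p q) (f q r) := by
  intro d
  induction d with
  | zero => intro p q r _ _ _ _ _; omega
  | succ d ih =>
    intro p q r hd hp hpq hqr hr
    rw [h p r hp (by omega) hr]
    rcases eq_or_ne q (p + 1) with rfl | h1
    · rcases eq_or_ne r (p + 2) with rfl | h2
      · rw [min_comm]; rfl
      · have e1 := ih p (p + 1) (r - 1) (by omega) hp (by omega) (by omega) (by omega)
        have e2 := h (p + 1) r (by omega) (by omega) hr
        have : f (p + 1) r ≤ f (p + 1) (r - 1) := e2 ▸ min_le_right _ _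
        grind
    · have e1 := ih (p + 1) q r (by omega) (by omega) (by omega) hqr hr
      rcases eq_or_ne q (r - 1) with rfl | h2
      · have : f p (r - 1) ≤ f (p + 1) (r - 1) := by
          rw [h p (r - 1) hp (by omega) (by omega)]
          exact min_le_left _ _
        grind
      · have e2 := ih p q (r - 1) (by omega) hp hpq (by omega) (by omega)
        have e3 : f q r ≤ f q (r - 1) := by
          rw [h q r (by omega) (by omega) hr]
          exact min_le_right _ _
        have e4 : f p q ≤ f (p + 1) q := by
          rw [h p q hp (by omega) (by omega)]
          exact min_le_left _ _
        grind

/-- If the product attached to a reduced word of the longest element and positive parameters is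
a Toeplitz matrix, then the valuations of the parameters satisfy the local rule. -/
theorem exists_hasRootVal_of_toeplitz {K : Type*} [Field K] {P : K → Prop} {v : K → ℝ}
    (hP : IsPositiveValuation P v) (l : ℕ) (L : List (ℕ × K))
    (hL : ∀ x ∈ L, 1 ≤ x.1 ∧ P x.2) (hlen : L.length = ∑ j ∈ Finset.range (l + 1), j)
    (hw : ∀ x, wordPerm (L.map Prod.fst) x = if 1 ≤ x ∧ x ≤ l + 1 then l + 2 - x else x)
    (hT : ∀ r c, r + 1 < l + 1 → c + 1 < l + 1 →
      L.foldr rowAct (idFun K) r c = L.foldr rowAct (idFun K) (r + 1) (c + 1)) :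
    ∃ f : ℕ → ℕ → ℝ,
      (∀ p q, 1 ≤ p → p + 2 ≤ q → q ≤ l + 1 → f p q = min (f (p + 1) q) (f p (q - 1))) ∧
      HasRootVal v (l + 1) f 1 L := by
  have hrev : ∀ p, 1 ≤ p → p ≤ l + 1 → wordPerm (L.map Prod.fst) p = l + 1 + 1 - p :=
    fun p h1 h2 => by rw [hw, if_pos ⟨h1, h2⟩]
  set S := (stdWord 1 l fun _ _ => (0 : K)).map Prod.fst with hS
  have hwS : wordPerm (L.map Prod.fst) = wordPerm S := by
    ext x
    rw [hw, hS, wordPerm_stdWord]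
    grind
  obtain ⟨L', hL', hrel⟩ := exists_braidRel _ L S rfl
    (isReducedWord_of_reverse hrev (by rw [List.length_map, hlen]))
    (isReducedWord_of_reverse (by rwa [← hwS]) (by rw [hS, List.length_map, length_stdWord]))
    hwS
  obtain ⟨e, rfl⟩ := exists_eq_stdWord l 1 _ L' hL'
  obtain ⟨hpos, hprod, -⟩ :=
    hrel.transfer hP (n := l + 1) (f := fun _ _ => 0) (fun _ _ _ _ _ _ _ => (min_self _).symm) hL
  have hrule := stdWord_local_rule hP l e
    (fun k r hkr => (hpos _ (mem_stdWord l 1 e k r hkr)).2)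
    (by simpa only [hprod] using hT)
  set f : ℕ → ℕ → ℝ := fun p q => v (e (l + 1 - q) (p - 1)) with hf
  have hlocal : ∀ p q, 1 ≤ p → p + 2 ≤ q → q ≤ l + 1 →
      f p q = min (f (p + 1) q) (f p (q - 1)) := by
    intro p q h1 h2 h3
    have := hrule (l + 1 - q) (p - 1) (by omega)
    rw [min_comm, show l + 1 - q + 1 = l + 1 - (q - 1) by omega,
      show p - 1 + 1 = p + 1 - 1 by omega] at this
    exact this
  refine ⟨f, hlocal, (hrel.transfer hP (fun p q r => eq_min_of_local_rule _ f hlocal _ p q r rfl)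
    hL).2.2 1 (hasRootVal_stdWord l 1 e 1 le_rfl (fun j _ => ?_) fun a b hab => ?_)⟩
  · rw [Equiv.Perm.one_apply, add_comm]
  · simp only [hf]
    rw [show l + 1 - (l + 1 - a) = a by omega, Nat.add_sub_cancel]

theorem permApp_mul {n : ℕ} (σ τ : Equiv.Perm (Fin n)) (x : ℕ) :
    permApp (σ * τ) x = permApp σ (permApp τ x) := by
  by_cases h : 1 ≤ x ∧ x ≤ n
  · have := (τ ⟨x - 1, by omega⟩).isLt
    simp only [permApp, dif_pos h]
    rw [dif_pos (by omega)]
    rfl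
  · simp [permApp, dif_neg h]

theorem permApp_sPerm {n i : ℕ} (h : 1 ≤ i ∧ i < n) (x : ℕ) :
    permApp (sPerm n i) x = natSwap i x := by
  rw [natSwap_apply]
  by_cases hx : 1 ≤ x ∧ x ≤ n
  · simp only [permApp, dif_pos hx, sPerm, dif_pos h, Equiv.swap_apply_def, Fin.mk.injEq]
    split_ifs <;> simp <;> omega
  · simp only [permApp, dif_neg hx]
    grind

theorem permApp_prod_sPerm {n : ℕ} (x : List ℕ) (hx : ∀ i ∈ x, 1 ≤ i ∧ i < n) (p : ℕ) :
    permApp (x.map (sPerm n)).prod p = wordPerm x p := by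
  induction x with
  | nil =>
    simp only [List.map_nil, List.prod_nil, wordPerm_nil, Equiv.Perm.one_apply, permApp]
    split_ifs <;> omega
  | cons i x ih =>
    rw [List.map_cons, List.prod_cons, permApp_mul, ih fun j hj => hx j (by simp [hj]),
      permApp_sPerm (hx i (by simp)), wordPerm_cons, Equiv.Perm.mul_apply]

theorem permApp_w0Perm (n x : ℕ) :
    permApp (w0Perm n) x = if 1 ≤ x ∧ x ≤ n then n + 1 - x else x := by
  simp only [permApp]
  split_ifs with h
  · change n - 1 - (x - 1) + 1 = _
    omega
  · rfl

theorem prod_yMat_apply {n : ℕ} {K : Type*} [Field K] (L : List (ℕ × K))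
    (hL : ∀ x ∈ L, 1 ≤ x.1 ∧ x.1 < n) (a b : Fin n) :
    (L.map fun x => yMat n K x.1 x.2).prod a b = L.foldr rowAct (idFun K) a b := by
  induction L generalizing a with
  | nil => simp [idFun, Matrix.one_apply, Fin.ext_iff]
  | cons x L ih =>
    have hx := hL x (by simp)
    have ih' := fun c => ih (fun y hy => hL y (by simp [hy])) c
    rw [List.map_cons, List.prod_cons, Matrix.mul_apply, List.foldr_cons, rowAct]
    split_ifs with h
    · have hsum (c : Fin n) : yMat n K x.1 x.2 a c =
          (if c = a then 1 else 0) + if c = ⟨x.1 - 1, by omega⟩ then x.2 else 0 := by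
        simp only [yMat, Fin.ext_iff]
        grind
      simp [hsum, add_mul, Finset.sum_add_distrib, ih', h]
    · have hsum (c : Fin n) : yMat n K x.1 x.2 a c = if c = a then 1 else 0 := by
        simp only [yMat, Fin.ext_iff]
        grind
      simp [hsum, ih']

theorem isPositiveValuation_gps :
    IsPositiveValuation (fun x : GPS => 0 < x.leadingCoeff) HahnSeries.order := by
  have hne (x : GPS) (hx : 0 < x.leadingCoeff) : x ≠ 0 := by
    rintro rfl
    simp at hx
  have hmul (x y : GPS) (hx : 0 < x.leadingCoeff) (hy : 0 < y.leadingCoeff) :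
      0 < (x * y).leadingCoeff := by
    rw [HahnSeries.leadingCoeff_mul]
    exact mul_pos hx hy
  have hadd (x y : GPS) (hx : 0 < x.leadingCoeff) (hy : 0 < y.leadingCoeff)
      (hxy : x.order ≤ y.order) :
      0 < (x + y).leadingCoeff ∧ (x + y).order = x.order := by
    have h0 : x ≠ 0 := hne x hx
    have h1 : y ≠ 0 := hne y hy
    rw [HahnSeries.leadingCoeff_eq] at hx hy
    have hc : 0 < (x + y).coeff x.order := by
      rw [HahnSeries.coeff_add]
      rcases hxy.eq_or_lt with h | h
      · rw [h] at hx ⊢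
        exact add_pos hx hy
      · rwa [HahnSeries.coeff_eq_zero_of_lt_order h, add_zero]
    have h2 : x + y ≠ 0 := by
      intro h
      simp [h] at hc
    have h3 : (x + y).order = x.order :=
      le_antisymm (HahnSeries.order_le_of_coeff_ne_zero hc.ne')
        (by simpa [min_eq_left hxy] using HahnSeries.min_order_le_order_add h2)
    exact ⟨by rwa [HahnSeries.leadingCoeff_eq, h3], h3⟩
  refine ⟨hne, fun x y hx hy => ?_, hmul, fun x hx => ?_, by simp, fun x y hx hy => ?_,
    fun x y hx hy => HahnSeries.order_mul (hne x hx) (hne y hy), fun x hx => ?_⟩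
  · rcases le_total x.order y.order with h | h
    · exact (hadd x y hx hy h).1
    · rw [add_comm]
      exact (hadd y x hy hx h).1
  · have h := HahnSeries.leadingCoeff_mul x x⁻¹
    rw [mul_inv_cancel₀ (hne x hx), HahnSeries.leadingCoeff_one] at h
    exact pos_of_mul_pos_right (h ▸ one_pos) hx.le
  · rcases le_total x.order y.order with h | h
    · rw [(hadd x y hx hy h).2, min_eq_left h]
    · rw [add_comm, (hadd y x hy hx h).2, min_eq_right h]
  · have h := HahnSeries.order_mul (hne x hx) (inv_ne_zero (hne x hx))
    rw [mul_inv_cancel₀ (hne x hx), HahnSeries.order_one] at h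
    linarith

/-- if the product y_{i_1}(m_1⁻¹)⋯y_{i_N}(m_N⁻¹) built from a reduced
expression for w₀ and positive generalized Puiseux series with non-negative valuations
is a Toeplitz matrix, then the valuations, indexed by the associated positive roots,
form an ideal filling. -/
theorem stmt0
    (n N : ℕ) (hn : 2 ≤ n) (hN : N = n * (n - 1) / 2)
    (i : ℕ → ℕ)
    (hirange : ∀ j, 1 ≤ j → j ≤ N → 1 ≤ i j ∧ i j ≤ n - 1)
    (hired : ((List.range N).map (fun t => sPerm n (i (t + 1)))).prod = w0Perm n)
    (β : ℕ → ℕ × ℕ)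
    (hβ : ∀ j, β j =
      (permApp (((List.range (j - 1)).map (fun t => sPerm n (i (t + 1)))).prod) (i j),
       permApp (((List.range (j - 1)).map (fun t => sPerm n (i (t + 1)))).prod) (i j + 1)))
    (m : ℕ → GPS)
    (hm0 : ∀ j, 1 ≤ j → j ≤ N → m j ≠ 0)
    (hmpos : ∀ j, 1 ≤ j → j ≤ N → 0 < (m j).coeff (m j).order)
    (hmval : ∀ j, 1 ≤ j → j ≤ N → 0 ≤ (m j).order)
    (Y : Matrix (Fin n) (Fin n) GPS)
    (hY : Y = ((List.range N).map (fun t => yMat n GPS (i (t + 1)) (m (t + 1))⁻¹)).prod)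
    (hToeplitz : ∀ a b : Fin n, ∀ (ha : (a : ℕ) + 1 < n) (hb : (b : ℕ) + 1 < n),
      Y a b = Y ⟨(a : ℕ) + 1, ha⟩ ⟨(b : ℕ) + 1, hb⟩)
    (μ : ℕ → ℕ → ℝ)
    (hμ : ∀ j, 1 ≤ j → j ≤ N → μ (β j).1 (β j).2 = (m j).order) :
    (∀ a b, 1 ≤ a → a < b → b ≤ n → 0 ≤ μ a b) ∧
    (∀ a b, 1 ≤ a → a < b → b ≤ n → 2 ≤ b - a →
      μ a b = max (μ (a + 1) b) (μ a (b - 1))) := by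
  have hv := isPositiveValuation_gps
  have hm (j : ℕ) (h1 : 1 ≤ j) (h2 : j ≤ N) : 0 < (m j).leadingCoeff := by
    rw [HahnSeries.leadingCoeff_eq]
    exact hmpos j h1 h2
  obtain ⟨l, rfl⟩ : ∃ l, n = l + 1 := ⟨n - 1, by omega⟩
  set L : List (ℕ × GPS) := (List.range N).map fun t => (i (t + 1), (m (t + 1))⁻¹) with hL
  have hletter : ∀ x ∈ L, (1 ≤ x.1 ∧ x.1 < l + 1) ∧ 0 < x.2.leadingCoeff := by
    intro x hx
    obtain ⟨t, ht, rfl⟩ := List.mem_map.mp hx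
    have ht' := List.mem_range.mp ht
    have := hirange (t + 1) (by omega) (by omega)
    exact ⟨⟨this.1, by omega⟩, hv.inv _ (hm _ (by omega) (by omega))⟩
  have hLlen : L.length = N := by simp [hL]
  have hfst (j : ℕ) : (List.range j).map (fun t => sPerm (l + 1) (i (t + 1))) =
      ((List.range j).map fun t => i (t + 1)).map (sPerm (l + 1)) := by
    rw [List.map_map]
    rfl
  have hLfst (j : ℕ) (hj : j ≤ N) :
      (L.map Prod.fst).take j = (List.range j).map fun t => i (t + 1) := by
    rw [hL, List.map_map, ← List.map_take, List.take_range, min_eq_left hj]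
    rfl
  have hperm (j : ℕ) (hj : j ≤ N) (p : ℕ) :
      permApp ((List.range j).map (fun t => sPerm (l + 1) (i (t + 1)))).prod p =
        wordPerm ((L.map Prod.fst).take j) p := by
    rw [hfst, hLfst j hj]
    refine permApp_prod_sPerm _ (fun x hx => ?_) p
    obtain ⟨t, ht, rfl⟩ := List.mem_map.mp hx
    have ht' := List.mem_range.mp ht
    have := hirange (t + 1) (by omega) (by omega)
    omega
  have hw (x : ℕ) : wordPerm (L.map Prod.fst) x = if 1 ≤ x ∧ x ≤ l + 1 then l + 2 - x else x := by
    rw [← permApp_w0Perm (l + 1), ← hired, hperm N le_rfl, List.take_of_length_le]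
    simp [hLlen]
  have hYL (a b : Fin (l + 1)) : Y a b = L.foldr rowAct (idFun GPS) a b := by
    rw [← prod_yMat_apply L (fun x hx => (hletter x hx).1), hY, hL, List.map_map]
    rfl
  obtain ⟨f, hlocal, hroot⟩ := exists_hasRootVal_of_toeplitz hv l L
    (fun x hx => ⟨(hletter x hx).1.1, (hletter x hx).2⟩)
    (by rw [hLlen, hN, Finset.sum_range_id]) hw (fun r c hr hc => by
      have := hToeplitz ⟨r, by omega⟩ ⟨c, by omega⟩ hr hc
      rwa [hYL, hYL] at this)
  have hval (p q : ℕ) (hp : 1 ≤ p) (hpq : p < q) (hq : q ≤ l + 1) :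
      0 ≤ μ p q ∧ μ p q = - f p q := by
    have hinv (y : ℕ) (h1 : 1 ≤ y) (h2 : y ≤ l + 1) :
        (wordPerm (L.map Prod.fst))⁻¹ y = l + 2 - y := by
      rw [Equiv.Perm.inv_eq_iff_eq, hw, if_pos (by omega)]
      omega
    obtain ⟨j, hj, h1, h2⟩ := exists_root_of_inversion (L.map Prod.fst) p q hpq (by
      rw [hinv p (by omega) (by omega), hinv q (by omega) (by omega)]
      omega)
    have hjN : j < N := by simpa [hLlen] using hj
    have hget := hroot.getElem L 1 j (by omega)
    have hμj := hμ (j + 1) (by omega) (by omega)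
    rw [hβ, Nat.add_sub_cancel, hperm j hjN.le, hperm j hjN.le] at hμj
    simp only [hL, List.getElem_map, List.getElem_range] at h1 h2 hget
    rw [← hL] at h1 h2 hget
    rw [one_mul, List.map_take, h1, h2, hv.map_inv _ (hm _ (by omega) (by omega))] at hget
    rw [h1, h2] at hμj
    exact ⟨hμj ▸ hmval _ (by omega) (by omega), by rw [hμj, ← hget, neg_neg]⟩
  refine ⟨fun a b ha hab hb => (hval a b ha hab hb).1, fun a b ha hab hb hba => ?_⟩
  rw [(hval a b ha hab hb).2, (hval (a + 1) b (by omega) (by omega) hb).2,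
    (hval a (b - 1) ha (by omega) (by omega)).2, max_neg_neg,
    ← hlocal a b ha (by omega) hb]
end

section
/- Let 𝕂 be a field, n ≥ 2, N = n(n−1)/2, let (i_1,…,i_N) be a reduced expression for the longest element w₀ of S_n, and let z_1,…,z_N ∈ 𝕂ˣ. Set A := x_{−i_1}(z_1)·x_{−i_2}(z_2)⋯x_{−i_N}(z_N). If (w̄₀·Aᵀ)⁻¹ = L·D·U with L lower triangular with all diagonal entries 1, D diagonal, and U upper triangular with all diagonal entries 1, then D is the identity matrix. -/
open Matrix

/-- The monomial matrix whose column `b` is `ε b` times the basis vector of index `w b`. -/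
def monomialMat {m 𝕂 : Type*} [DecidableEq m] [Zero 𝕂] (w : Equiv.Perm m) (ε : m → 𝕂) :
    Matrix m m 𝕂 :=
  fun a b => if a = w b then ε b else 0

section MonomialMat

variable {m 𝕂 : Type*} [Fintype m] [DecidableEq m] [Field 𝕂]

lemma mul_monomialMat_apply (w : Equiv.Perm m) (ε : m → 𝕂) (M : Matrix m m 𝕂) (a b : m) :
    (M * monomialMat w ε) a b = M a (w b) * ε b := by
  simp [Matrix.mul_apply, monomialMat]

lemma monomialMat_mul_apply (w : Equiv.Perm m) (ε : m → 𝕂) (M : Matrix m m 𝕂) (a b : m) :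
    (monomialMat w ε * M) (w a) b = ε a * M a b := by
  simp [Matrix.mul_apply, monomialMat]

lemma mul_transpose_monomialMat_apply (w : Equiv.Perm m) (ε : m → 𝕂) (M : Matrix m m 𝕂)
    (a b : m) : (M * (monomialMat w ε)ᵀ) a (w b) = M a b * ε b := by
  simp [Matrix.mul_apply, monomialMat]

lemma transpose_monomialMat_mul_apply (w : Equiv.Perm m) (ε : m → 𝕂) (M : Matrix m m 𝕂)
    (a b : m) : ((monomialMat w ε)ᵀ * M) a b = ε a * M (w a) b := by
  simp [Matrix.mul_apply, monomialMat]

lemma monomialMat_mul_monomialMat (w v : Equiv.Perm m) (ε δ : m → 𝕂) :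
    monomialMat w ε * monomialMat v δ = monomialMat (w * v) (fun b => ε (v b) * δ b) := by
  ext a b
  rw [mul_monomialMat_apply]
  simp only [monomialMat, Equiv.Perm.mul_apply, ite_mul, zero_mul]
  congr

lemma monomialMat_mul_transpose {w : Equiv.Perm m} {ε : m → 𝕂} (hε : ∀ a, ε a * ε a = 1) :
    monomialMat w ε * (monomialMat w ε)ᵀ = 1 := by
  ext a b
  obtain ⟨a, rfl⟩ := w.surjective a
  obtain ⟨b, rfl⟩ := w.surjective b
  rw [mul_transpose_monomialMat_apply, Matrix.one_apply]
  by_cases h : a = b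
  · subst h; simp [monomialMat, hε]
  · simp [monomialMat, h]

lemma transpose_monomialMat_mul {w : Equiv.Perm m} {ε : m → 𝕂} (hε : ∀ a, ε a * ε a = 1) :
    (monomialMat w ε)ᵀ * monomialMat w ε = 1 :=
  mul_eq_one_comm.mp (monomialMat_mul_transpose hε)

end MonomialMat

/-- Upper triangular matrices with unit diagonal. -/
def IsUpperUnitriangular {n : ℕ} {𝕂 : Type*} [Field 𝕂] (M : Matrix (Fin n) (Fin n) 𝕂) : Prop :=
  (∀ a, M a a = 1) ∧ ∀ a b, b < a → M a b = 0

section Unitriangular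

variable {n : ℕ} {𝕂 : Type*} [Field 𝕂]

lemma IsUpperUnitriangular.one : IsUpperUnitriangular (1 : Matrix (Fin n) (Fin n) 𝕂) :=
  ⟨fun a => by simp, fun a b h => by simp [h.ne']⟩

lemma IsUpperUnitriangular.mul {M M' : Matrix (Fin n) (Fin n) 𝕂}
    (hM : IsUpperUnitriangular M) (hM' : IsUpperUnitriangular M') :
    IsUpperUnitriangular (M * M') := by
  refine ⟨fun a => ?_, fun a b hab => ?_⟩
  · rw [Matrix.mul_apply, Finset.sum_eq_single a, hM.1, hM'.1, one_mul]
    · intro c _ hc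
      rcases lt_or_gt_of_ne hc with h | h
      · rw [hM.2 _ _ h, zero_mul]
      · rw [hM'.2 _ _ h, mul_zero]
    · simp
  · rw [Matrix.mul_apply]
    refine Finset.sum_eq_zero fun c _ => ?_
    rcases lt_or_ge c a with h | h
    · rw [hM.2 _ _ h, zero_mul]
    · rw [hM'.2 _ _ (hab.trans_le h), mul_zero]

lemma IsUpperUnitriangular.transvection {p q : Fin n} (h : p < q) (c : 𝕂) :
    IsUpperUnitriangular (transvection p q c) := by
  refine ⟨fun a => ?_, fun a b hab => ?_⟩
  · have : ¬ (p = a ∧ q = a) := by rintro ⟨rfl, rfl⟩; exact h.ne rfl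
    simp [Matrix.transvection, this]
  · have : ¬ (p = a ∧ q = b) := by rintro ⟨rfl, rfl⟩; exact hab.not_gt h
    simp [Matrix.transvection, this, hab.ne']

/-- A diagonal matrix lying between lower and upper unitriangular factors of `1` is `1`. -/
lemma diagonal_eq_one_of_mul_eq_one {Λ D Υ : Matrix (Fin n) (Fin n) 𝕂}
    (hΛ : IsUpperUnitriangular Λᵀ) (hD : ∀ a b, a ≠ b → D a b = 0)
    (hΥ : IsUpperUnitriangular Υ) (h : Λ * D * Υ = 1) : D = 1 := by
  have hT : ∀ a b, (Λ * D) a b = Λ a b * D b b := fun a b => by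
    rw [Matrix.mul_apply, Finset.sum_eq_single b]
    · intro c _ hc
      rw [hD c b hc, mul_zero]
    · simp
  have hΥtri : Υ.BlockTriangular id := fun a b hab => hΥ.2 a b hab
  have hdet : IsUnit Υ.det := by
    rw [Matrix.det_of_isUpperTriangular hΥtri]
    simp [hΥ.1]
  have := Υ.invertibleOfIsUnitDet hdet
  have hinv : Λ * D = Υ⁻¹ := (Matrix.inv_eq_left_inv h).symm
  have hup : (Λ * D).BlockTriangular id :=
    hinv ▸ Matrix.blockTriangular_inv_of_blockTriangular hΥtri
  ext a b
  by_cases hab : a = b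
  · subst hab
    have h1 := congrFun (congrFun h a) a
    rw [Matrix.mul_apply, Finset.sum_eq_single a, hT, hΥ.1] at h1
    · have := hΛ.1 a
      rw [Matrix.transpose_apply] at this
      simpa [this] using h1
    · intro c _ hc
      rcases lt_or_gt_of_ne hc with h | h
      · rw [hup h, zero_mul]
      · rw [hΥ.2 _ _ h, mul_zero]
    · simp
  · rw [hD a b hab, Matrix.one_apply_ne hab]

end Unitriangular

section SignedPermutation

variable {n : ℕ}

lemma swap_lt_swap_of_adjacent {p q a b : Fin n} (hpq : (p : ℕ) + 1 = q) (hab : a < b)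
    (h : ¬ (a = p ∧ b = q)) : Equiv.swap p q a < Equiv.swap p q b := by
  simp only [Equiv.swap_apply_def]
  simp only [Fin.ext_iff, Fin.lt_def] at *
  split_ifs <;> omega

/-- The inversions of a permutation. -/
def inversions (w : Equiv.Perm (Fin n)) : Finset (Fin n × Fin n) :=
  Finset.univ.filter fun x => x.1 < x.2 ∧ w x.2 < w x.1

lemma mem_inversions {w : Equiv.Perm (Fin n)} {x : Fin n × Fin n} :
    x ∈ inversions w ↔ x.1 < x.2 ∧ w x.2 < w x.1 := by
  simp [inversions]

lemma card_inversions_mul_swap_erase_le {p q : Fin n} (hpq : (p : ℕ) + 1 = q)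
    (w : Equiv.Perm (Fin n)) :
    ((inversions (w * Equiv.swap p q)).erase (p, q)).card ≤ (inversions w).card := by
  refine Finset.card_le_card_of_injOn (fun x => (Equiv.swap p q x.1, Equiv.swap p q x.2)) ?_ ?_
  · rintro ⟨a, b⟩ hx
    simp only [Finset.mem_coe, Finset.mem_erase, mem_inversions, ne_eq, Prod.mk.injEq,
      Equiv.Perm.mul_apply] at hx ⊢
    exact ⟨swap_lt_swap_of_adjacent hpq hx.2.1 hx.1, hx.2.2⟩
  · rintro ⟨a, b⟩ _ ⟨c, d⟩ _ h
    simpa using h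

lemma card_inversions_mul_swap_le {p q : Fin n} (hpq : (p : ℕ) + 1 = q)
    (w : Equiv.Perm (Fin n)) :
    (inversions (w * Equiv.swap p q)).card ≤ (inversions w).card + 1 := by
  have := card_inversions_mul_swap_erase_le hpq w
  have := Finset.pred_card_le_card_erase (s := inversions (w * Equiv.swap p q)) (a := (p, q))
  omega

lemma lt_of_card_inversions_lt {p q : Fin n} (hpq : (p : ℕ) + 1 = q) (w : Equiv.Perm (Fin n))
    (h : (inversions w).card < (inversions (w * Equiv.swap p q)).card) : w p < w q := by
  by_contra hlt
  have hmem : (p, q) ∉ inversions (w * Equiv.swap p q) := by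
    simp only [mem_inversions, Equiv.Perm.mul_apply, Equiv.swap_apply_left,
      Equiv.swap_apply_right]
    exact fun hx => hlt hx.2
  have := card_inversions_mul_swap_erase_le hpq w
  rw [Finset.erase_eq_of_notMem hmem] at this
  omega

lemma inversions_one : inversions (1 : Equiv.Perm (Fin n)) = ∅ := by
  ext ⟨a, b⟩
  simp only [mem_inversions, Equiv.Perm.one_apply, Finset.notMem_empty, iff_false]
  exact fun h => h.1.not_gt h.2

lemma card_inversions_w0Perm : (inversions (w0Perm n)).card = n * (n - 1) / 2 := by
  have h : inversions (w0Perm n) =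
      ((Finset.univ : Finset (Fin n)).sigma fun b => Finset.Iio b).map
        ⟨fun x => (x.2, x.1), by rintro ⟨a, b⟩ ⟨c, d⟩ h; simp at h; simp [h]⟩ := by
    ext ⟨a, b⟩
    simp only [mem_inversions, Finset.mem_map, Finset.mem_sigma, Finset.mem_univ, true_and,
      Finset.mem_Iio]
    constructor
    · intro h
      exact ⟨⟨b, a⟩, h.1, rfl⟩
    · rintro ⟨⟨b', a'⟩, h, heq⟩
      obtain ⟨rfl, rfl⟩ := Prod.mk.inj heq
      refine ⟨h, ?_⟩
      simp only [w0Perm, Equiv.coe_fn_mk, Fin.lt_def] at h ⊢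
      omega
  rw [h, Finset.card_map, Finset.card_sigma]
  simp only [Fin.card_Iio]
  rw [Fin.sum_univ_eq_sum_range (fun x => x), Finset.sum_range_id]

variable (𝕂 : Type*) [Field 𝕂]

/-- The parity sign of the number of inversions of `w` having right endpoint `b`. -/
def inversionSign (w : Equiv.Perm (Fin n)) (b : Fin n) : 𝕂 :=
  ∏ k, if k < b ∧ w b < w k then -1 else 1

lemma inversionSign_mul_self (w : Equiv.Perm (Fin n)) (b : Fin n) :
    inversionSign 𝕂 w b * inversionSign 𝕂 w b = 1 := by
  rw [inversionSign, ← Finset.prod_mul_distrib]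
  refine Finset.prod_eq_one fun k _ => ?_
  split_ifs <;> simp

/-- The lift of `w` to a signed permutation matrix along any reduced word. -/
def signedPermMat (w : Equiv.Perm (Fin n)) : Matrix (Fin n) (Fin n) 𝕂 :=
  monomialMat w (inversionSign 𝕂 w)

/-- The lift of the simple reflection `swap p q`. -/
def simpleLift (p q : Fin n) : Matrix (Fin n) (Fin n) 𝕂 :=
  monomialMat (Equiv.swap p q) (fun b => if b = q then -1 else 1)

lemma signedPermMat_one : signedPermMat 𝕂 (1 : Equiv.Perm (Fin n)) = 1 := by
  ext a b
  have : inversionSign 𝕂 1 b = 1 := Finset.prod_eq_one fun k _ =>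
    if_neg fun h => h.1.not_gt h.2
  simp [signedPermMat, monomialMat, this, Matrix.one_apply]

lemma signedPermMat_mul_simpleLift {p q : Fin n} (hpq : (p : ℕ) + 1 = q)
    {w : Equiv.Perm (Fin n)} (hw : w p < w q) :
    signedPermMat 𝕂 w * simpleLift 𝕂 p q = signedPermMat 𝕂 (w * Equiv.swap p q) := by
  rw [signedPermMat, simpleLift, monomialMat_mul_monomialMat, signedPermMat]
  congr 1
  funext b
  have hne : p ≠ q := by rintro rfl; omega
  have hsingle : (if b = q then (-1 : 𝕂) else 1) = ∏ k, if k = q ∧ b = q then -1 else 1 := by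
    by_cases hb : b = q <;> simp [hb, Finset.prod_ite_eq']
  rw [hsingle, inversionSign, inversionSign, ← Finset.prod_mul_distrib]
  conv_rhs => rw [← Equiv.prod_comp (Equiv.swap p q)]
  refine Finset.prod_congr rfl fun k _ => ?_
  simp only [Equiv.Perm.mul_apply, Equiv.swap_apply_self]
  by_cases hbq : b = q
  · subst hbq
    by_cases hkq : k = b
    · subst hkq
      have h1 : ¬ k < p := by rw [Fin.lt_def]; omega
      have h2 : p < k := by rw [Fin.lt_def]; omega
      simp [h1, h2, hw]
    · have : k < p ↔ Equiv.swap p b k < b := by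
        rw [Equiv.swap_apply_def]
        simp only [Fin.ext_iff, Fin.lt_def] at *
        split_ifs <;> omega
      simp [hkq, this]
  · have : (k < Equiv.swap p q b ∧ w (Equiv.swap p q b) < w k) ↔
        (Equiv.swap p q k < b ∧ w (Equiv.swap p q b) < w k) := by
      by_cases h : k = p ∧ b = p
      · rw [h.1, h.2, Equiv.swap_apply_left]
        exact iff_of_false (fun h => h.2.not_gt hw) (fun h => h.2.not_gt hw)
      · refine and_congr_left fun hlt => ?_
        have hne : k ≠ Equiv.swap p q b := by rintro rfl; exact hlt.ne rfl
        rw [Equiv.swap_apply_def] at hne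
        rw [Equiv.swap_apply_def, Equiv.swap_apply_def]
        simp only [Fin.ext_iff, Fin.lt_def, ne_eq] at *
        split_ifs at * <;> omega
    simp [hbq, this]

lemma signedPermMat_w0Perm : signedPermMat 𝕂 (w0Perm n) = w0bar n 𝕂 := by
  ext a b
  have hs : inversionSign 𝕂 (w0Perm n) b = (-1) ^ (b : ℕ) := by
    have : ∀ k : Fin n, (k < b ∧ w0Perm n b < w0Perm n k) ↔ k ∈ Finset.Iio b := fun k => by
      simp only [w0Perm, Equiv.coe_fn_mk, Fin.lt_def, Finset.mem_Iio]
      omega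
    simp only [inversionSign, this, Finset.prod_ite_mem, Finset.univ_inter, Finset.prod_const,
      Fin.card_Iio]
  simp only [signedPermMat, monomialMat, hs, w0bar]
  have : a = w0Perm n b ↔ (a : ℕ) + b = n - 1 := by
    simp only [w0Perm, Equiv.coe_fn_mk, Fin.ext_iff]
    omega
  simp only [this]
  split_ifs with h
  · congr 1; omega
  · rfl

end SignedPermutation

section BruhatCell

variable {n : ℕ} {𝕂 : Type*} [Field 𝕂]

lemma xNegMat_eq {p q : Fin n} (hpq : (p : ℕ) + 1 = q) {z : 𝕂} (hz : z ≠ 0) :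
    xNegMat n 𝕂 q z = transvection p q z⁻¹ * simpleLift 𝕂 p q * transvection p q z := by
  have hne : p ≠ q := by rintro rfl; omega
  have hne' := hne.symm
  have hP : ∀ a : Fin n, (a : ℕ) + 1 = q ↔ a = p := fun a => by rw [Fin.ext_iff]; omega
  have hS : ∀ a b, simpleLift 𝕂 p q a b =
      if b = q then (if a = p then -1 else 0) else if b = p then (if a = q then 1 else 0)
        else if a = b then 1 else 0 := fun a b => by
    simp only [simpleLift, monomialMat, Equiv.swap_apply_def]
    split_ifs <;> simp_all
  ext a b
  simp only [xNegMat, hP, ← Fin.ext_iff]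
  by_cases hb : b = q
  · subst hb
    rw [mul_transvection_apply_same]
    by_cases ha : a = p
    · subst ha
      simp [transvection_mul_apply_same, hS, hne, hne', hz]
    · by_cases haq : a = b <;> simp [transvection_mul_apply_of_ne, ha, haq, hS, hne, hne']
  · rw [mul_transvection_apply_of_ne _ _ _ _ hb]
    by_cases ha : a = p
    · subst ha
      by_cases hbp : b = a
      · simp [transvection_mul_apply_same, hS, hne, hbp]
      · simp [transvection_mul_apply_same, hS, hne, hb, hbp, Ne.symm hb, Ne.symm hbp]
    · rw [transvection_mul_apply_of_ne _ _ _ _ ha, hS]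
      by_cases hbp : b = p <;> simp [hb, hbp, ha, hne]

/-- Right multiplication of a Bruhat cell by a simple reflection that increases length. -/
lemma exists_signedPermMat_mul_simpleLift {p q : Fin n} (hpq : (p : ℕ) + 1 = q)
    {w : Equiv.Perm (Fin n)} (hw : w p < w q) {u : Matrix (Fin n) (Fin n) 𝕂}
    (hu : IsUpperUnitriangular u) :
    ∃ v v', IsUpperUnitriangular v ∧ IsUpperUnitriangular v' ∧
      signedPermMat 𝕂 w * u * simpleLift 𝕂 p q =
        v * signedPermMat 𝕂 (w * Equiv.swap p q) * v' := by
  have hne : p ≠ q := by rintro rfl; omega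
  have hlt : p < q := by rw [Fin.lt_def]; omega
  set P := signedPermMat 𝕂 w with hP
  set S := simpleLift 𝕂 p q with hS
  set c := u p q
  have hPP : Pᵀ * P = 1 := transpose_monomialMat_mul (inversionSign_mul_self 𝕂 w)
  have hSS : S * Sᵀ = 1 := monomialMat_mul_transpose fun a => by split_ifs <;> simp
  set u' := transvection p q (-c) * u with hu'
  have hu'U : IsUpperUnitriangular u' := (IsUpperUnitriangular.transvection hlt _).mul hu
  have hu'pq : u' p q = 0 := by
    rw [hu', transvection_mul_apply_same, hu.1]
    simp [c]
  refine ⟨P * transvection p q c * Pᵀ, Sᵀ * u' * S, ?_, ?_, ?_⟩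
  · have hPP' : P * Pᵀ = 1 := mul_eq_one_comm.mp hPP
    have : P * transvection p q c * Pᵀ =
        transvection (w p) (w q) (inversionSign 𝕂 w p * c * inversionSign 𝕂 w q) := by
      rw [transvection, mul_add, add_mul, mul_one, hPP', transvection]
      congr 1
      ext a b
      obtain ⟨a, rfl⟩ := w.surjective a
      obtain ⟨b, rfl⟩ := w.surjective b
      rw [hP, signedPermMat, mul_transpose_monomialMat_apply, monomialMat_mul_apply]
      simp only [Matrix.single_apply, EmbeddingLike.apply_eq_iff_eq]
      split_ifs with h
      · rw [h.1, h.2]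
      · simp
    rw [this]
    exact IsUpperUnitriangular.transvection hw _
  · have hent : ∀ a b, (Sᵀ * u' * S) a b = (if a = q then -1 else 1) *
        u' (Equiv.swap p q a) (Equiv.swap p q b) * (if b = q then -1 else 1) := fun a b => by
      rw [hS, simpleLift, mul_monomialMat_apply, transpose_monomialMat_mul_apply]
    refine ⟨fun a => ?_, fun a b hab => ?_⟩
    · rw [hent, hu'U.1]
      split_ifs <;> simp
    · rw [hent]
      by_cases h : b = p ∧ a = q
      · rw [h.1, h.2, Equiv.swap_apply_left, Equiv.swap_apply_right, hu'pq]
        simp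
      · rw [hu'U.2 _ _ (swap_lt_swap_of_adjacent hpq hab h)]
        simp
  · rw [← signedPermMat_mul_simpleLift 𝕂 hpq hw]
    have ht : transvection p q c * transvection p q (-c) = 1 := by
      rw [transvection_mul_transvection_same _ _ hne]
      simp
    calc P * u * S = P * (transvection p q c * transvection p q (-c)) * u * S := by
          rw [ht, mul_one]
      _ = P * transvection p q c * (Pᵀ * P) * (S * Sᵀ) * (transvection p q (-c) * u) * S := by
          rw [hPP, hSS]; simp only [mul_one, mul_assoc]
      _ = P * transvection p q c * Pᵀ * (P * S) * (Sᵀ * u' * S) := by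
          simp only [hu', mul_assoc]

end BruhatCell

/-- for A = x_{−i_1}(z_1)⋯x_{−i_N}(z_N) built from a reduced expression
for w₀, if (w̄₀·Aᵀ)⁻¹ = L·D·U with L lower unitriangular, D diagonal and U upper
unitriangular, then D = 1. -/
theorem stmt2 (𝕂 : Type*) [Field 𝕂]
    (n N : ℕ) (hn : 2 ≤ n) (hN : N = n * (n - 1) / 2)
    (i : ℕ → ℕ)
    (hirange : ∀ j, 1 ≤ j → j ≤ N → 1 ≤ i j ∧ i j ≤ n - 1)
    (hired : ((List.range N).map (fun t => sPerm n (i (t + 1)))).prod = w0Perm n)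
    (z : ℕ → 𝕂) (hz : ∀ j, 1 ≤ j → j ≤ N → z j ≠ 0)
    (A : Matrix (Fin n) (Fin n) 𝕂)
    (hA : A = ((List.range N).map (fun t => xNegMat n 𝕂 (i (t + 1)) (z (t + 1)))).prod)
    (L D U : Matrix (Fin n) (Fin n) 𝕂)
    (hL : ∀ a b : Fin n, a < b → L a b = 0) (hLdiag : ∀ a : Fin n, L a a = 1)
    (hD : ∀ a b : Fin n, a ≠ b → D a b = 0)
    (hU : ∀ a b : Fin n, b < a → U a b = 0) (hUdiag : ∀ a : Fin n, U a a = 1)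
    (hLDU : (w0bar n 𝕂 * A.transpose)⁻¹ = L * D * U) :
    D = 1 := by
  subst hN
  set N := n * (n - 1) / 2
  set w : ℕ → Equiv.Perm (Fin n) := fun k =>
    ((List.range k).map (fun t => sPerm n (i (t + 1)))).prod with hw
  have hstep : ∀ k, k < N → ∃ p q : Fin n, (p : ℕ) + 1 = q ∧ (q : ℕ) = i (k + 1) ∧
      w (k + 1) = w k * Equiv.swap p q := fun k hk => by
    have hi := hirange (k + 1) (by omega) (by omega)
    refine ⟨⟨i (k + 1) - 1, by omega⟩, ⟨i (k + 1), by omega⟩, by simp; omega, rfl, ?_⟩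
    have : sPerm n (i (k + 1)) = Equiv.swap ⟨i (k + 1) - 1, by omega⟩ ⟨i (k + 1), by omega⟩ :=
      dif_pos (by omega)
    simp [hw, List.range_succ, this]
  have hgrow : ∀ j k, k + j = N → N ≤ (inversions (w k)).card + j := fun j => by
    induction j with
    | zero =>
      rintro k rfl
      rw [show w N = w0Perm n from hired, card_inversions_w0Perm]
      simp [N]
    | succ j ih =>
      intro k hk
      obtain ⟨p, q, hpq, -, hs⟩ := hstep k (by omega)
      have h1 := ih (k + 1) (by omega)
      have h2 := card_inversions_mul_swap_le hpq (w k)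
      rw [hs] at h1
      omega
  have hbound : ∀ k, k ≤ N → (inversions (w k)).card ≤ k := fun k => by
    induction k with
    | zero => intro _; simp [hw, inversions_one]
    | succ k ih =>
      intro hk
      obtain ⟨p, q, hpq, -, hs⟩ := hstep k (by omega)
      have h2 := card_inversions_mul_swap_le hpq (w k)
      have := ih (by omega)
      rw [hs]
      omega
  have hcell : ∀ k, k ≤ N → ∃ v v', IsUpperUnitriangular v ∧ IsUpperUnitriangular v' ∧
      ((List.range k).map (fun t => xNegMat n 𝕂 (i (t + 1)) (z (t + 1)))).prod =
        v * signedPermMat 𝕂 (w k) * v' := fun k => by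
    induction k with
    | zero =>
      intro _
      exact ⟨1, 1, .one, .one, by simp [hw, signedPermMat_one]⟩
    | succ k ih =>
      intro hk
      obtain ⟨v, v', hv, hv', hprod⟩ := ih (by omega)
      obtain ⟨p, q, hpq, hqi, hs⟩ := hstep k (by omega)
      have hlt : w k p < w k q := by
        refine lt_of_card_inversions_lt hpq (w k) ?_
        have h1 := hbound k (by omega)
        have h2 := hgrow (N - (k + 1)) (k + 1) (by omega)
        rw [hs] at h2
        omega
      have hT : ∀ c : 𝕂, IsUpperUnitriangular (transvection p q c) := fun c =>
        .transvection (by rw [Fin.lt_def]; omega) c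
      obtain ⟨y, y', hy, hy', heq⟩ :=
        exists_signedPermMat_mul_simpleLift hpq hlt (hv'.mul (hT (z (k + 1))⁻¹))
      refine ⟨v * y, y' * transvection p q (z (k + 1)), hv.mul hy, hy'.mul (hT _), ?_⟩
      rw [List.range_succ, List.map_append, List.prod_append, hprod, List.map_singleton,
        List.prod_singleton, ← hqi, xNegMat_eq hpq (hz _ (by omega) (by omega)), hs]
      calc _ = v * (signedPermMat 𝕂 (w k) * (v' * transvection p q (z (k + 1))⁻¹) *
              simpleLift 𝕂 p q) * transvection p q (z (k + 1)) := by simp only [mul_assoc]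
        _ = _ := by rw [heq]; simp only [mul_assoc]
  obtain ⟨v, v', hv, hv', hprod⟩ := hcell N le_rfl
  rw [← hA, show w N = w0Perm n from hired] at hprod
  set W := signedPermMat 𝕂 (w0Perm n) with hW
  rw [← signedPermMat_w0Perm, hprod, ← hW] at hLDU
  set V := W * v'ᵀ * Wᵀ with hVdef
  have hV : IsUpperUnitriangular V := by
    have hent : ∀ a b, V (w0Perm n a) (w0Perm n b) =
        inversionSign 𝕂 (w0Perm n) a * v' b a * inversionSign 𝕂 (w0Perm n) b := fun a b => by
      rw [hVdef, hW, signedPermMat, mul_transpose_monomialMat_apply, monomialMat_mul_apply,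
        Matrix.transpose_apply]
    refine ⟨fun a => ?_, fun a b hab => ?_⟩
    · obtain ⟨a, rfl⟩ := (w0Perm n).surjective a
      rw [hent, hv'.1, mul_one, inversionSign_mul_self]
    · obtain ⟨a, rfl⟩ := (w0Perm n).surjective a
      obtain ⟨b, rfl⟩ := (w0Perm n).surjective b
      have : a < b := by
        simp only [w0Perm, Equiv.coe_fn_mk, Fin.lt_def] at hab ⊢
        omega
      rw [hent, hv'.2 _ _ this]
      simp
  have hM : W * (v * W * v')ᵀ = V * vᵀ := by
    simp only [Matrix.transpose_mul, hVdef, mul_assoc]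
  rw [hM] at hLDU
  have hdet : ∀ X : Matrix (Fin n) (Fin n) 𝕂, IsUpperUnitriangular X → X.det = 1 :=
    fun X hX => by
      rw [Matrix.det_of_isUpperTriangular (fun a b hab => hX.2 a b hab)]
      simp [hX.1]
  have hunit : IsUnit (V * vᵀ).det := by
    rw [Matrix.det_mul, Matrix.det_transpose, hdet V hV, hdet v hv]
    simp
  have h1 : L * D * U * (V * vᵀ) = 1 := hLDU ▸ Matrix.nonsing_inv_mul _ hunit
  have h2 : vᵀ * L * D * (U * V) = 1 := by
    have : (L * D * U * V) * vᵀ = 1 := by rw [← h1]; simp only [mul_assoc]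
    rw [← mul_eq_one_comm.mp this]
    simp only [mul_assoc]
  refine diagonal_eq_one_of_mul_eq_one ?_ hD (IsUpperUnitriangular.mul ⟨hUdiag, hU⟩ hV) h2
  rw [Matrix.transpose_mul, Matrix.transpose_transpose]
  exact IsUpperUnitriangular.mul ⟨hLdiag, fun a b h => hL b a h⟩ hv
end
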